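/- Let f : S² → S² be a ramified covering, let 𝒜 be a contracted, countable, strongly f-stable set of disjoint α-paths, and let Φ : S² ∖ Im 𝒜 → S² ∖ Im ℬ be a regluing of 𝒜 into a contracted set ℬ of disjoint β-paths. Then there exists a continuous map g : S² → S² that is a ramified covering and satisfies g(Φ(x)) = Φ(f(x)) for every x ∈ S² ∖ Im 𝒜. -/

import Mathlib

open Set Filter Topology OnePoint

noncomputable section

abbrev Sph : Type := Metric.sphere (0 : EuclideanSpace ℝ (Fin 3)) 1

/-- The unit circle in the plane. -/
def circS : Set (ℝ × ℝ) := {p | p.1 ^ 2 + p.2 ^ 2 = 1}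

abbrev OP : Type := OnePoint (ℝ × ℝ)

/-- The closed outside `Δ̄∞` of the unit circle in the one-point compactification of the plane. -/
def deltaBar : Set OP := insert ∞ ((fun p : ℝ × ℝ => (p : OP)) '' {p | 1 ≤ p.1 ^ 2 + p.2 ^ 2})

/-- The unit circle viewed inside the one-point compactification of the plane. -/
def circOP : Set OP := (fun p : ℝ × ℝ => (p : OP)) '' circS

/-- The open outside `Δ∞` of the unit circle. -/
def deltaInf : Set OP := deltaBar \ circOP

/-- An α-path: `α (t₁,t₂) = α (t₁',t₂')` iff `t₁ = t₁'` and `t₂ = ±t₂'`. -/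
def IsAlphaPath (α : ℝ × ℝ → Sph) : Prop :=
  ContinuousOn α circS ∧
    ∀ p ∈ circS, ∀ q ∈ circS, (α p = α q ↔ p.1 = q.1 ∧ (p.2 = q.2 ∨ p.2 = -q.2))

/-- A β-path: `β (t₁,t₂) = β (t₁',t₂')` iff `t₁ = ±t₁'` and `t₂ = t₂'`. -/
def IsBetaPath (β : ℝ × ℝ → Sph) : Prop :=
  ContinuousOn β circS ∧
    ∀ p ∈ circS, ∀ q ∈ circS, (β p = β q ↔ (p.1 = q.1 ∨ p.1 = -q.1) ∧ p.2 = q.2)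

/-- The image of a path (its values on the unit circle). -/
def pathIm (α : ℝ × ℝ → Sph) : Set Sph := α '' circS

/-- `Im 𝒜`: the union of the images of the members of a family of paths. -/
def famIm (A : Set (ℝ × ℝ → Sph)) : Set Sph := ⋃ α ∈ A, pathIm α

/-- A family of paths with pairwise disjoint images. -/
def DisjointPaths (A : Set (ℝ × ℝ → Sph)) : Prop :=
  A.Pairwise fun α α' => Disjoint (pathIm α) (pathIm α')

/-- `ext` is an extension `α̂ : Δ̄∞ → S²` of the α-path `α`: it is continuous on `Δ̄∞`,
restricts to `α` on the unit circle, and maps `Δ∞` homeomorphically onto `S² ∖ α(S¹)`. -/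
def IsExtension (α : ℝ × ℝ → Sph) (ext : OP → Sph) : Prop :=
  ContinuousOn ext deltaBar ∧ (∀ p ∈ circS, ext (p : OP) = α p) ∧
    Topology.IsEmbedding (deltaInf.restrict ext) ∧ ext '' deltaInf = (pathIm α)ᶜ

/-- `Φ` is a regluing of the family `A` of α-paths (with chosen extensions `ext`) into the
family `B` of β-paths, according to the correspondence `b : α ↦ β_α`.  Only the values of `Φ`
on `S² ∖ Im A` matter: `Φ` restricts to a continuous bijection `S² ∖ Im A → S² ∖ Im B`, and
for every `α ∈ A` and `p ∈ S¹`, `Φ (α̂ z)` tends to `β_α p` as `z` tends to `p` within `Δ∞`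
(along the points where `Φ` is defined, i.e. where `α̂ z ∉ Im A`). -/
structure IsRegluing (A : Set (ℝ × ℝ → Sph)) (ext : (ℝ × ℝ → Sph) → OP → Sph)
    (B : Set (ℝ × ℝ → Sph)) (b : (ℝ × ℝ → Sph) → ℝ × ℝ → Sph) (Φ : Sph → Sph) : Prop where
  bijOn : Set.BijOn Φ (famIm A)ᶜ (famIm B)ᶜ
  contOn : ContinuousOn Φ (famIm A)ᶜ
  tendsto : ∀ α ∈ A, ∀ p ∈ circS,
    Filter.Tendsto (fun z => Φ (ext α z))
      (𝓝[deltaInf ∩ ext α ⁻¹' (famIm A)ᶜ] ((p : ℝ × ℝ) : OP)) (𝓝 (b α p))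

/-- The data of a set `A` of disjoint α-paths with chosen extensions `ext`, a set `B` of
disjoint β-paths, and a bijection `b : α ↦ β_α` from `A` to `B`. -/
structure RegluingData (A : Set (ℝ × ℝ → Sph)) (ext : (ℝ × ℝ → Sph) → OP → Sph)
    (B : Set (ℝ × ℝ → Sph)) (b : (ℝ × ℝ → Sph) → ℝ × ℝ → Sph) : Prop where
  alpha : ∀ α ∈ A, IsAlphaPath α
  disjA : DisjointPaths A
  extOk : ∀ α ∈ A, IsExtension α (ext α)
  beta : ∀ β ∈ B, IsBetaPath β
  disjB : DisjointPaths B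
  bij : Set.BijOn b A B

/-- The open unit disk in ℂ. -/
def unitDisk : Set ℂ := Metric.ball 0 1

/-- `f` is a ramified covering of local degree `k` at `x`: in suitable local homeomorphic
coordinates identifying neighborhoods of `x` and `f x` with the unit disk (sending `x` and
`f x` to `0`), the map `f` becomes `z ↦ z ^ k`. -/
def IsRamifiedAt (f : Sph → Sph) (x : Sph) (k : ℕ) : Prop :=
  0 < k ∧ ∃ (U V : Set Sph) (hx : x ∈ U) (hfx : f x ∈ V) (hmap : Set.MapsTo f U V),
    IsOpen U ∧ IsOpen V ∧
      ∃ (φ : U ≃ₜ unitDisk) (ψ : V ≃ₜ unitDisk),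
        (φ ⟨x, hx⟩ : ℂ) = 0 ∧ (ψ ⟨f x, hfx⟩ : ℂ) = 0 ∧
          ∀ z : U, (ψ ⟨f z, hmap z.2⟩ : ℂ) = (φ z : ℂ) ^ k

/-- `f` is a ramified covering: a continuous map that is a ramified covering of some local
degree at every point. -/
def IsRamifiedCovering (f : Sph → Sph) : Prop :=
  Continuous f ∧ ∀ x : Sph, ∃ k : ℕ, IsRamifiedAt f x k

/-- A critical point of `f` is a point of local degree at least 2. -/
def IsCriticalPt (f : Sph → Sph) (x : Sph) : Prop := ∃ k, 2 ≤ k ∧ IsRamifiedAt f x k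

/-- A critical value of `f` is the image of a critical point. -/
def IsCriticalValue (f : Sph → Sph) (y : Sph) : Prop := ∃ x, IsCriticalPt f x ∧ f x = y

/-- A family of subsets of a metric space is contracted if for every `ε > 0` only finitely many
members have diameter exceeding `ε`. -/
def Contracted {X : Type*} [PseudoMetricSpace X] (S : Set (Set X)) : Prop :=
  ∀ ε > 0, {s ∈ S | ε < Metric.diam s}.Finite

/-- A countable set `A` of disjoint α-paths is `f`-stable. -/
def FStable (f : Sph → Sph) (A : Set (ℝ × ℝ → Sph)) : Prop :=
  (∀ α ∈ A,
      (∃ α' ∈ A, ∀ p ∈ circS, f (α p) = α' p) ∨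
        ((∀ p ∈ circS, f (α p) = f (α (-p.1, p.2))) ∧
          Disjoint (f '' pathIm α) (famIm A))) ∧
    f ⁻¹' famIm A ⊆ famIm A

/-- A countable set `A` of disjoint α-paths is strongly `f`-stable: it is `f`-stable, and every
critical point of `f` lying in `Im A` is a simple critical point of the form `α (0,1)` for some
`α ∈ A` satisfying `f (α (t₁,t₂)) = f (α (-t₁,t₂))` for all `(t₁,t₂) ∈ S¹`. -/
def StronglyFStable (f : Sph → Sph) (A : Set (ℝ × ℝ → Sph)) : Prop :=
  FStable f A ∧ ∀ x ∈ famIm A, IsCriticalPt f x →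
    IsRamifiedAt f x 2 ∧
      ∃ α ∈ A, x = α (0, 1) ∧ ∀ p ∈ circS, f (α p) = f (α (-p.1, p.2))


lemma exists_chart (c : Sph) {O : Set Sph} (hO : O ∈ 𝓝 c) :
    ∃ e : OpenPartialHomeomorph Sph ℂ, c ∈ e.source ∧ e c = 0 ∧ e.target = Metric.ball 0 1 ∧
      e.source ⊆ O := by
  have : Fact (Module.finrank ℝ (EuclideanSpace ℝ (Fin 3)) = 2 + 1) := ⟨by simp⟩
  let e0 : OpenPartialHomeomorph Sph ℂ :=
    (stereographic' 2 (-c)).trans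
      Complex.orthonormalBasisOneI.repr.symm.toHomeomorph.toOpenPartialHomeomorph
  have hs : e0.source = {-c}ᶜ := by simp [e0]
  have ht : e0.target = univ := by simp [e0]
  have hne : (c : Sph) ≠ -c := by
    intro h
    have h2 : (c : EuclideanSpace ℝ (Fin 3)) = -c := by
      have := congrArg Subtype.val h
      simpa using this
    have h3 : (c : EuclideanSpace ℝ (Fin 3)) = 0 := by
      have h5 : (2 : ℝ) • (c : EuclideanSpace ℝ (Fin 3)) = 0 := by
        rw [two_smul]; nth_rw 1 [h2]; simp
      simpa using h5
    have h4 := c.2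
    rw [h3] at h4
    simp at h4
  have hc : c ∈ e0.source := by rw [hs]; exact hne
  have h1 : e0.symm ⁻¹' O ∈ 𝓝 (e0 c) := by
    apply (e0.continuousAt_symm (by rw [ht]; trivial))
    rwa [e0.left_inv hc]
  obtain ⟨r, hr, hb⟩ := Metric.mem_nhds_iff.1 h1
  refine ⟨e0.trans (OpenPartialHomeomorph.unitBallBall (e0 c) r hr).symm, ?_, ?_, ?_, ?_⟩
  · simp [hc, hr]
  · simp [OpenPartialHomeomorph.unitBallBall]
  · rw [OpenPartialHomeomorph.trans_target]
    simp [ht]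
  · intro x hx
    rw [OpenPartialHomeomorph.trans_source] at hx
    have h2 : e0 x ∈ Metric.ball (e0 c) r := by simpa using hx.2
    have := hb h2
    simpa [e0.left_inv hx.1] using this

abbrev HP : Type := {z : ℂ | z.re < 0}

instance : LocallyPathConnectedSpace HP :=
  (isOpen_lt Complex.continuous_re continuous_const).locallyPathConnectedSpace

instance : ContractibleSpace HP :=
  Convex.contractibleSpace (convex_halfSpace_re_lt 0) ⟨-1, by simp⟩

/-- translation on the half plane -/
def hshift (n : ℤ) (z : HP) : HP := ⟨z + n * (2 * Real.pi * Complex.I), by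
  have := z.2
  simp only [mem_ofPred_eq] at this ⊢
  simpa using this⟩

lemma hshift_cont (n : ℤ) : Continuous (hshift n) := by
  unfold hshift
  fun_prop

lemma hshift_exp (n : ℤ) (z : HP) : Complex.exp (hshift n z : ℂ) = Complex.exp (z : ℂ) := by
  rw [Complex.exp_eq_exp_iff_exists_int]
  exact ⟨n, rfl⟩

lemma hshift_add (m n : ℤ) (z : HP) : hshift m (hshift n z) = hshift (m + n) z := by
  apply Subtype.ext
  simp only [hshift]
  push_cast
  ring

lemma hshift_zero (z : HP) : hshift 0 z = z := by
  apply Subtype.ext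
  simp [hshift]

lemma exists_hshift {z w : HP} (h : Complex.exp (z : ℂ) = Complex.exp (w : ℂ)) :
    ∃ n : ℤ, z = hshift n w := by
  rw [Complex.exp_eq_exp_iff_exists_int] at h
  obtain ⟨n, hn⟩ := h
  exact ⟨n, Subtype.ext hn⟩

lemma HP_exp_norm (z : HP) : ‖Complex.exp (z : ℂ)‖ < 1 := by
  rw [Complex.norm_exp]
  exact Real.exp_lt_one_iff.2 z.2

lemma exists_HP_exp {w : ℂ} (h0 : w ≠ 0) (h1 : ‖w‖ < 1) : ∃ z : HP, Complex.exp (z : ℂ) = w := by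
  refine ⟨⟨Complex.log w, ?_⟩, Complex.exp_log h0⟩
  simp only [mem_ofPred_eq, Complex.log_re]
  exact Real.log_neg (norm_pos_iff.2 h0) h1

lemma HP_exp_open : IsOpenMap (fun z : HP => Complex.exp (z : ℂ)) :=
  Complex.isOpenMap_exp.comp
    (isOpen_lt Complex.continuous_re continuous_const).isOpenEmbedding_subtypeVal.isOpenMap


structure StoData (g : Sph → Sph) (y : Sph) (K : Set Sph) (e : OpenPartialHomeomorph Sph ℂ) :
    Prop where
  cont : Continuous g
  comp : IsCompact K
  memK : K ∈ 𝓝 y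
  fib : ∀ z ∈ K, g z = g y → z = y
  bd : ∀ z ∈ K, g z ∈ e.source → K ∈ 𝓝 z
  loc : ∀ z ∈ K, z ≠ y → g z ∈ e.source →
    ∃ W ∈ 𝓝 z, IsOpen W ∧ InjOn g W ∧ ∀ O ⊆ W, IsOpen O → IsOpen (g '' O)
  tgt : e.target = Metric.ball 0 1
  src : g y ∈ e.source
  zero : e (g y) = 0

namespace StoData
variable {g : Sph → Sph} {y : Sph} {K : Set Sph} {e : OpenPartialHomeomorph Sph ℂ}

lemma cov (h : StoData g y K e) :
    IsCoveringMapOn (fun z : K => g z) (e.source \ {g y}) := by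
  have := isCompact_iff_compactSpace.1 h.comp
  apply IsCoveringMapOn.of_isLocalHomeomorphOn
  · exact h.cont.comp continuous_subtype_val
  rw [isLocalHomeomorphOn_iff_isOpenEmbedding_restrict]
  rintro ⟨z, hz⟩ ⟨hz1, hz2⟩
  obtain ⟨W, hW, hWo, hinj, hop⟩ := h.loc z hz (fun h' => hz2 (by simp [h'])) hz1
  have hK := h.bd z hz hz1
  let W' := W ∩ interior K
  have hW' : IsOpen W' := hWo.inter isOpen_interior
  refine ⟨Subtype.val ⁻¹' W', ?_, ?_⟩
  · exact (hW'.preimage continuous_subtype_val).mem_nhds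
      ⟨mem_of_mem_nhds hW, mem_interior_iff_mem_nhds.2 hK⟩
  refine IsOpenEmbedding.of_continuous_injective_isOpenMap ?_ ?_ ?_
  · exact h.cont.comp (continuous_subtype_val.comp continuous_subtype_val)
  · rintro ⟨⟨a, ha⟩, ha'⟩ ⟨⟨b, hb⟩, hb'⟩ hab
    have : a = b := hinj ha'.1 hb'.1 hab
    subst this
    rfl
  · intro O hO
    obtain ⟨O1, hO1, rfl⟩ := isOpen_induced_iff.1 hO
    obtain ⟨O2, hO2, rfl⟩ := isOpen_induced_iff.1 hO1
    have : ((Subtype.val ⁻¹' W').domRestrict (fun z : K => g z)) ''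
        (Subtype.val ⁻¹' (Subtype.val ⁻¹' O2)) = g '' (O2 ∩ W') := by
      ext v
      constructor
      · rintro ⟨⟨⟨a, ha⟩, ha'⟩, hm, rfl⟩
        exact ⟨a, ⟨hm, ha'⟩, rfl⟩
      · rintro ⟨a, ⟨ha, ha'⟩, rfl⟩
        exact ⟨⟨⟨a, interior_subset ha'.2⟩, ha'⟩, ha, rfl⟩
    rw [this]
    exact hop _ (fun a ha => ha.2.1) (hO2.inter hW')

lemma exp_mem (h : StoData g y K e) (z : HP) : Complex.exp (z : ℂ) ∈ e.target := by
  rw [h.tgt]; simpa using HP_exp_norm z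

lemma symm_mem (h : StoData g y K e) (z : HP) :
    e.symm (Complex.exp (z : ℂ)) ∈ e.source \ {g y} := by
  refine ⟨e.map_target (h.exp_mem z), ?_⟩
  intro h'
  have := congrArg e (mem_singleton_iff.1 h')
  rw [e.right_inv (h.exp_mem z), h.zero] at this
  exact Complex.exp_ne_zero _ this

/-- The base map. -/
def base (h : StoData g y K e) : C(HP, Sph) where
  toFun z := e.symm (Complex.exp (z : ℂ))
  continuous_toFun := by
    refine e.continuousOn_symm.comp_continuous ?_ h.exp_mem
    fun_prop

/-- A lift of the base map. -/
def IsLift (h : StoData g y K e) (F : HP → Sph) : Prop :=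
  Continuous F ∧ (∀ z, F z ∈ K) ∧ ∀ z, g (F z) = h.base z

lemma lift_unique (h : StoData g y K e) {F G : HP → Sph} (hF : h.IsLift F) (hG : h.IsLift G)
    {z : HP} (hz : F z = G z) : F = G := by
  obtain ⟨F0, -, h0⟩ := h.cov.existsUnique_continuousMap_lifts h.base (a₀ := z)
    (e₀ := ⟨F z, hF.2.1 z⟩) (hF.2.2 z) h.symm_mem
  have h1 := h0 ⟨fun z => ⟨F z, hF.2.1 z⟩, hF.1.subtype_mk _⟩ ⟨rfl, funext hF.2.2⟩
  have h2 := h0 ⟨fun z => ⟨G z, hG.2.1 z⟩, hG.1.subtype_mk _⟩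
    ⟨Subtype.ext hz.symm, funext hG.2.2⟩
  funext w
  have := DFunLike.congr_fun (h1.trans h2.symm) w
  exact congrArg Subtype.val this

lemma lift_exists (h : StoData g y K e) {d : Sph} (hd : d ∈ K) {z : HP} (hz : g d = h.base z) :
    ∃ F, h.IsLift F ∧ F z = d := by
  obtain ⟨F0, ⟨h1, h2⟩, -⟩ := h.cov.existsUnique_continuousMap_lifts h.base (a₀ := z)
    (e₀ := ⟨d, hd⟩) hz h.symm_mem
  refine ⟨fun w => F0 w, ⟨continuous_subtype_val.comp F0.continuous, fun w => (F0 w).2, fun w => ?_⟩, ?_⟩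
  · exact congrFun h2 w
  · show ((F0 z : K) : Sph) = d
    rw [h1]

lemma lift_ne (h : StoData g y K e) {F : HP → Sph} (hF : h.IsLift F) (z : HP) : F z ≠ y := by
  intro h'
  have := (h.symm_mem z).2
  apply this
  have h2 := hF.2.2 z
  rw [h'] at h2
  exact h2.symm

lemma base_open (h : StoData g y K e) : IsOpenMap h.base := by
  intro O hO
  have h1 := HP_exp_open O hO
  have : h.base '' O = e.symm '' ((fun z : HP => Complex.exp (z : ℂ)) '' O) := by
    rw [image_image]; rfl
  rw [this]
  apply e.isOpen_image_symm_of_subset_target h1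
  rintro _ ⟨z, -, rfl⟩
  exact h.exp_mem z

lemma lift_open (h : StoData g y K e) {F : HP → Sph} (hF : h.IsLift F) (z : HP) :
    𝓝 (F z) ≤ map F (𝓝 z) := by
  intro S hS
  obtain ⟨W, hW, hWo, hinj, -⟩ := h.loc (F z) (hF.2.1 z) (h.lift_ne hF z)
    (by rw [hF.2.2]; exact (h.symm_mem z).1)
  have hO : F ⁻¹' S ∩ F ⁻¹' W ∈ 𝓝 z :=
    inter_mem hS (hF.1.continuousAt hW)
  have h2 : h.base '' (F ⁻¹' S ∩ F ⁻¹' W) ∈ 𝓝 (g (F z)) := by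
    rw [hF.2.2]; exact h.base_open.image_mem_nhds hO
  filter_upwards [hW, h.cont.continuousAt h2] with d hd hd2
  obtain ⟨z', hz', hz2⟩ := hd2
  rw [← hF.2.2] at hz2
  have := hinj hz'.2 hd hz2
  rw [← this]; exact hz'.1

lemma base_surj (h : StoData g y K e) {d : Sph} (hd : d ∈ e.source) (hne : d ≠ g y) :
    ∃ z, h.base z = d := by
  have h1 : e d ∈ Metric.ball (0 : ℂ) 1 := by rw [← h.tgt]; exact e.map_source hd
  have h0 : e d ≠ 0 := by
    intro h'
    exact hne (e.injOn hd h.src (by rw [h', h.zero]))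
  obtain ⟨z, hz⟩ := exists_HP_exp h0 (by simpa using h1)
  refine ⟨z, ?_⟩
  show e.symm (Complex.exp (z : ℂ)) = d
  rw [hz, e.left_inv hd]

lemma fib_tendsto (h : StoData g y K e) {ι : Type*} {l : Filter ι} {a : ι → Sph}
    (haK : ∀ i, a i ∈ K) (ha : Tendsto (fun i => g (a i)) l (𝓝 (g y))) : Tendsto a l (𝓝 y) := by
  rw [tendsto_iff_ultrafilter]
  intro u hu
  obtain ⟨x, hx, hux⟩ := isCompact_iff_ultrafilter_le_nhds.1 h.comp (u.map a)
    (le_principal_iff.2 (show a ⁻¹' K ∈ (u : Filter ι) from Filter.univ_mem' haK))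
  have h1 : Tendsto (fun i => g (a i)) u (𝓝 (g x)) :=
    (h.cont.tendsto x).comp hux
  have h2 := tendsto_nhds_unique h1 (ha.mono_left hu)
  rw [h.fib x hx h2] at hux
  exact hux

lemma lift_surj (h : StoData g y K e) {F : HP → Sph} (hF : h.IsLift F) {d : Sph} (hd : d ∈ K)
    (hne : d ≠ y) (hs : g d ∈ e.source) : ∃ z, F z = d := by
  by_contra hcon
  obtain ⟨w, hw⟩ := h.base_surj hs (fun h' => hne (h.fib d hd h'))
  obtain ⟨G, hG, hGw⟩ := h.lift_exists hd hw.symm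
  -- a small connected punctured neighbourhood of `y`
  have hN : K ∩ g ⁻¹' e.source ∈ 𝓝 y :=
    inter_mem h.memK (h.cont.continuousAt (e.open_source.mem_nhds h.src))
  obtain ⟨c, hc1, hc2, hc3, hc4⟩ := exists_chart y hN
  let P : Set Sph := c.symm '' (range (fun z : HP => Complex.exp (z : ℂ)))
  have htm : ∀ z : HP, Complex.exp (z : ℂ) ∈ c.target := fun z => by
    rw [hc3]; simpa using HP_exp_norm z
  have hPc : IsPreconnected P := by
    apply IsPreconnected.image
    · apply isPreconnected_range; fun_prop
    · apply c.continuousOn_symm.mono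
      rintro _ ⟨z, rfl⟩
      exact htm z
  have hPn : ∀ z ∈ c.source, z ≠ y → z ∈ P := by
    intro z hz hzy
    have h1 : c z ∈ Metric.ball (0 : ℂ) 1 := by rw [← hc3]; exact c.map_source hz
    have h0 : c z ≠ 0 := fun h' => hzy (c.injOn hz hc1 (by rw [h', hc2]))
    obtain ⟨t, ht⟩ := exists_HP_exp h0 (by simpa using h1)
    exact ⟨c z, ⟨t, ht⟩, c.left_inv hz⟩
  have hPs : ∀ z ∈ P, z ∈ c.source ∧ z ≠ y := by
    rintro _ ⟨_, ⟨t, rfl⟩, rfl⟩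
    refine ⟨c.map_target (htm t), fun h' => ?_⟩
    have := congrArg c h'
    rw [c.right_inv (htm t), hc2] at this
    exact Complex.exp_ne_zero _ this
  -- images of lifts
  have hopen : ∀ {H : HP → Sph}, h.IsLift H → IsOpen (range H) := by
    intro H hH
    rw [isOpen_iff_mem_nhds]
    rintro _ ⟨z, rfl⟩
    exact h.lift_open hH z (by simp)
  have hmeet : ∀ {H : HP → Sph}, h.IsLift H → (P ∩ range H).Nonempty := by
    intro H hH
    have ht : Tendsto (fun n : ℕ => e.symm ((1/2 : ℂ) ^ (n+1))) atTop (𝓝 (g y)) := by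
      have h0 : (0 : ℂ) ∈ e.target := by rw [h.tgt]; simp
      have h1 : Tendsto (fun n : ℕ => ((1/2 : ℂ) ^ (n+1))) atTop (𝓝 0) :=
        (tendsto_pow_atTop_nhds_zero_of_norm_lt_one (by norm_num)).comp (tendsto_add_atTop_nat 1)
      have h2 := (e.continuousAt_symm h0).tendsto.comp h1
      rw [← h.zero, e.left_inv h.src] at h2
      exact h2
    have hex : ∀ n : ℕ, ∃ z : HP, Complex.exp (z : ℂ) = (1/2 : ℂ) ^ (n+1) := fun n =>
      exists_HP_exp (pow_ne_zero _ (by norm_num)) (by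
        rw [norm_pow]
        apply pow_lt_one₀ (norm_nonneg _) (by norm_num) (by omega))
    choose z hz using hex
    have h3 : Tendsto (fun n => H (z n)) atTop (𝓝 y) := by
      apply h.fib_tendsto (fun n => hH.2.1 _)
      refine ht.congr (fun n => ?_)
      rw [hH.2.2, ← hz]; rfl
    obtain ⟨n, hn⟩ := (h3.eventually (c.open_source.mem_nhds hc1)).exists
    exact ⟨H (z n), hPn _ hn (h.lift_ne hH _), mem_range_self _⟩
  -- the complement of the image of F
  have hU : IsOpen (⋃ H ∈ {H | h.IsLift H ∧ Disjoint (range H) (range F)}, range H) :=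
    isOpen_biUnion fun H hH => hopen hH.1
  have hdis : ∀ {H : HP → Sph}, h.IsLift H → ∀ {x}, x ∈ range H → x ∉ range F →
      Disjoint (range H) (range F) := by
    intro H hH x hx hxF
    rw [Set.disjoint_left]
    rintro _ ⟨a, rfl⟩ ⟨b, hb⟩
    have hab : Complex.exp (b : ℂ) = Complex.exp (a : ℂ) := by
      have h1 : h.base b = h.base a := by rw [← hF.2.2, ← hH.2.2, hb]
      exact e.symm.injOn (h.exp_mem b) (h.exp_mem a) h1
    obtain ⟨n, hn⟩ := exists_hshift hab
    have hF' : h.IsLift (F ∘ hshift n) := ⟨hF.1.comp (hshift_cont n), fun z => hF.2.1 _, fun z => by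
      show g (F (hshift n z)) = _
      rw [hF.2.2]
      show e.symm _ = e.symm _
      rw [hshift_exp]⟩
    have heq : F ∘ hshift n = H := h.lift_unique hF' hH (z := a) (by
      show F (hshift n a) = H a
      rw [← hn, hb])
    obtain ⟨t, rfl⟩ := hx
    apply hxF
    rw [← heq]
    exact mem_range_self _
  have hGd : Disjoint (range G) (range F) := hdis hG (x := d) ⟨w, hGw⟩ (fun ⟨z, hz⟩ => hcon ⟨z, hz⟩)
  obtain ⟨x, hxP, hxF, hxU⟩ := hPc (range F) _ (hopen hF) hU (by
    intro x hx
    by_cases hxF : x ∈ range F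
    · exact Or.inl hxF
    · right
      have h1 := hPs x hx
      have h2 := hc4 h1.1
      obtain ⟨w, hw⟩ := h.base_surj h2.2 (fun h' => h1.2 (h.fib x h2.1 h'))
      obtain ⟨H, hH, hHw⟩ := h.lift_exists h2.1 hw.symm
      have hm : x ∈ range H := ⟨w, hHw⟩
      exact mem_biUnion (show H ∈ {H | h.IsLift H ∧ Disjoint (range H) (range F)} from
        ⟨hH, hdis hH hm hxF⟩) hm) (hmeet hF) (by
    obtain ⟨x, hx1, hx2⟩ := hmeet hG
    exact ⟨x, hx1, mem_biUnion (show G ∈ {H | h.IsLift H ∧ Disjoint (range H) (range F)} from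
        ⟨hG, hGd⟩) hx2⟩)
  obtain ⟨H, hH, hxH⟩ := mem_iUnion₂.1 hxU
  exact Set.disjoint_left.1 hH.2 hxH hxF

end StoData


namespace StoData
variable {g : Sph → Sph} {y : Sph} {K : Set Sph} {e : OpenPartialHomeomorph Sph ℂ}

lemma shift_lift (h : StoData g y K e) {F : HP → Sph} (hF : h.IsLift F) (n : ℤ) :
    h.IsLift (F ∘ hshift n) := ⟨hF.1.comp (hshift_cont n), fun z => hF.2.1 _, fun z => by
      show g (F (hshift n z)) = _
      rw [hF.2.2]
      show e.symm _ = e.symm _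
      rw [hshift_exp]⟩

lemma fibre_finite (h : StoData g y K e) {v : Sph} (hv : v ∈ e.source) (hne : v ≠ g y) :
    (K ∩ g ⁻¹' {v}).Finite := by
  have hc : IsCompact (K ∩ g ⁻¹' {v}) :=
    h.comp.inter_right (isClosed_singleton.preimage h.cont)
  apply hc.finite
  rw [isDiscrete_iff_nhdsNE]
  rintro z ⟨hz, hz2⟩
  obtain ⟨W, hW, hWo, hinj, -⟩ := h.loc z hz (fun h' => hne (by rw [← h']; exact hz2.symm))
    (by rw [show g z = v from hz2]; exact hv)
  rw [inf_principal_eq_bot]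
  filter_upwards [mem_nhdsWithin_of_mem_nhds hW, self_mem_nhdsWithin] with a ha hne ha2
  exact hne (hinj ha (mem_of_mem_nhds hW) (ha2.2.trans hz2.symm))

lemma exists_period (h : StoData g y K e) {F : HP → Sph} (hF : h.IsLift F) :
    ∃ k : ℕ, 0 < k ∧ ∀ z w : HP, F z = F w ↔
      Complex.exp ((z : ℂ) / k) = Complex.exp ((w : ℂ) / k) := by
  let H : AddSubgroup ℤ :=
    { carrier := {n | ∀ z, F (hshift n z) = F z}
      zero_mem' := fun z => by rw [hshift_zero]
      add_mem' := fun {a b} ha hb z => by rw [← hshift_add, ha, hb]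
      neg_mem' := fun {a} ha z => by
        rw [← ha (hshift (-a) z), hshift_add, add_neg_cancel, hshift_zero] }
  have hHm : ∀ n, n ∈ H ↔ ∀ z, F (hshift n z) = F z := fun n => Iff.rfl
  have hH1 : ∀ n z, F (hshift n z) = F z → n ∈ H := by
    intro n z hz
    rw [hHm]
    have := h.lift_unique (h.shift_lift hF n) hF (z := z) hz
    exact fun w => congrFun this w
  obtain ⟨a, ha⟩ := Int.subgroup_cyclic H
  rw [← AddSubgroup.zmultiples_eq_closure] at ha
  have ha0 : a ≠ 0 := by
    rintro rfl
    have hz0 : HP := ⟨-1, by simp⟩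
    have hfin := h.fibre_finite (h.symm_mem hz0).1 (h.symm_mem hz0).2
    have hinj : Function.Injective (fun n : ℤ => F (hshift n hz0)) := by
      intro m n hmn
      have : m - n ∈ H := hH1 (m - n) (hshift n hz0) (by
        rw [hshift_add, sub_add_cancel]; exact hmn)
      rw [ha] at this
      simp at this
      omega
    refine (Set.infinite_range_of_injective hinj) (hfin.subset ?_)
    rintro _ ⟨n, rfl⟩
    refine ⟨hF.2.1 _, ?_⟩
    show g (F _) = _
    exact (h.shift_lift hF n).2.2 hz0
  refine ⟨a.natAbs, Int.natAbs_pos.2 ha0, ?_⟩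
  have hk : ((a.natAbs : ℕ) : ℂ) ≠ 0 := by
    exact_mod_cast (Int.natAbs_pos.2 ha0).ne'
  have hmem : ∀ n : ℤ, n ∈ H ↔ ∃ j : ℤ, n = j * a.natAbs := by
    intro n
    rw [ha, Int.mem_zmultiples_iff, ← Int.natAbs_dvd]
    constructor
    · rintro ⟨j, hj⟩; exact ⟨j, by rw [hj, mul_comm]⟩
    · rintro ⟨j, hj⟩; exact ⟨j, by rw [hj, mul_comm]⟩
  clear ha ha0
  generalize a.natAbs = kk at hk hmem
  intro z w
  constructor
  · intro hzw
    have hexp : Complex.exp (z : ℂ) = Complex.exp (w : ℂ) := by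
      have h1 : h.base z = h.base w := by rw [← hF.2.2, ← hF.2.2, hzw]
      exact e.symm.injOn (h.exp_mem z) (h.exp_mem w) h1
    obtain ⟨n, hn⟩ := exists_hshift hexp
    rw [hn] at hzw
    obtain ⟨j, hj⟩ := (hmem n).1 (hH1 n w hzw)
    rw [Complex.exp_eq_exp_iff_exists_int]
    refine ⟨j, ?_⟩
    rw [hn, hj]
    simp only [hshift]
    field_simp
    push_cast
    ring
  · intro hzw
    rw [Complex.exp_eq_exp_iff_exists_int] at hzw
    obtain ⟨j, hj⟩ := hzw
    have : z = hshift (j * kk) w := by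
      apply Subtype.ext
      simp only [hshift]
      field_simp at hj
      rw [hj]
      push_cast
      ring
    rw [this]
    exact (hHm _).1 ((hmem _).2 ⟨j, rfl⟩) w

lemma ramified (h : StoData g y K e) : ∃ k, IsRamifiedAt g y k := by
  have hDo : IsOpen (K ∩ g ⁻¹' e.source) := by
    rw [isOpen_iff_mem_nhds]
    rintro z ⟨hz, hz2⟩
    exact inter_mem (h.bd z hz hz2) (h.cont.continuousAt (e.open_source.mem_nhds hz2))
  have hyD : y ∈ K ∩ g ⁻¹' e.source := ⟨mem_of_mem_nhds h.memK, h.src⟩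
  -- a starting lift
  obtain ⟨F, hF⟩ : ∃ F, h.IsLift F := by
    obtain ⟨c, hc1, hc2, hc3, hc4⟩ := exists_chart y (hDo.mem_nhds hyD)
    have hm : (1/2 : ℂ) ∈ c.target := by rw [hc3]; simp; norm_num
    have hs := c.map_target hm
    have hne : c.symm (1/2) ≠ y := by
      intro h'
      have := congrArg c h'
      rw [c.right_inv hm, hc2] at this
      norm_num at this
    obtain ⟨w, hw⟩ := h.base_surj (hc4 hs).2 (fun h' => hne (h.fib _ (hc4 hs).1 h'))
    obtain ⟨G, hG, -⟩ := h.lift_exists (hc4 hs).1 hw.symm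
    exact ⟨G, hG⟩
  obtain ⟨k, hk, hper⟩ := h.exists_period hF
  have hkC : (k : ℂ) ≠ 0 := by exact_mod_cast hk.ne'
  have hFD : ∀ z, F z ∈ K ∩ g ⁻¹' e.source := fun z => ⟨hF.2.1 z, by
    show g (F z) ∈ e.source
    rw [hF.2.2]; exact (h.symm_mem z).1⟩
  have hsur : ∀ d : (K ∩ g ⁻¹' e.source : Set Sph), ∃ z : HP, (d : Sph) ≠ y → F z = d := by
    intro d
    by_cases hd : (d : Sph) = y
    · exact ⟨⟨-1, by simp⟩, fun h' => absurd hd h'⟩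
    · obtain ⟨z, hz⟩ := h.lift_surj hF d.2.1 hd d.2.2
      exact ⟨z, fun _ => hz⟩
  choose ξ hξ using hsur
  have hex : ∀ w : unitDisk, ∃ z : HP, (w : ℂ) ≠ 0 → Complex.exp ((z : ℂ) / k) = w := by
    intro w
    by_cases hw : (w : ℂ) = 0
    · exact ⟨⟨-1, by simp⟩, fun h' => absurd hw h'⟩
    · have hw1 : ‖(w : ℂ)‖ < 1 := by
        have := w.2
        unfold unitDisk at this
        simpa using this
      obtain ⟨z, hz⟩ := exists_HP_exp hw hw1
      refine ⟨⟨k * z, ?_⟩, fun _ => ?_⟩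
      · have := z.2
        simp only [mem_ofPred_eq] at this ⊢
        simp
        exact mul_neg_of_pos_of_neg (by exact_mod_cast hk) this
      · rw [← hz]
        congr 1
        field_simp
  choose lam hlam using hex
  have hdisk : ∀ z : HP, Complex.exp ((z : ℂ) / k) ∈ unitDisk := by
    intro z
    unfold unitDisk
    rw [mem_ball_zero_iff, Complex.norm_exp, Real.exp_lt_one_iff]
    have : ((z : ℂ) / k).re = (z : ℂ).re / k := by
      rw [Complex.div_natCast_re]
    rw [this]
    exact div_neg_of_neg_of_pos z.2 (by exact_mod_cast hk)
  have h0disk : (0 : ℂ) ∈ unitDisk := by unfold unitDisk; simp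
  classical
  let φ : (K ∩ g ⁻¹' e.source : Set Sph) → unitDisk := fun d =>
    if (d : Sph) = y then ⟨0, h0disk⟩ else ⟨_, hdisk (ξ d)⟩
  let χ : unitDisk → (K ∩ g ⁻¹' e.source : Set Sph) := fun w =>
    if (w : ℂ) = 0 then ⟨y, hyD⟩ else ⟨_, hFD (lam w)⟩
  have hφy : φ ⟨y, hyD⟩ = ⟨0, h0disk⟩ := by simp [φ]
  have hχ0 : χ ⟨0, h0disk⟩ = ⟨y, hyD⟩ := by simp [χ]
  have hφF : ∀ z, φ ⟨F z, hFD z⟩ = ⟨_, hdisk z⟩ := by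
    intro z
    have hne := h.lift_ne hF z
    simp only [φ, hne, if_false]
    apply Subtype.ext
    exact (hper _ _).1 (hξ ⟨F z, hFD z⟩ hne)
  have hχe : ∀ z, χ ⟨_, hdisk z⟩ = ⟨F z, hFD z⟩ := by
    intro z
    have hne := Complex.exp_ne_zero ((z : ℂ) / k)
    simp only [χ, hne, if_false]
    apply Subtype.ext
    exact (hper _ _).2 (hlam ⟨_, hdisk z⟩ hne)
  have hcaseD : ∀ d : (K ∩ g ⁻¹' e.source : Set Sph), d = ⟨y, hyD⟩ ∨ ∃ z, d = ⟨F z, hFD z⟩ := by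
    intro d
    by_cases hd : (d : Sph) = y
    · exact Or.inl (Subtype.ext hd)
    · exact Or.inr ⟨ξ d, Subtype.ext (hξ d hd).symm⟩
  have hcaseW : ∀ w : unitDisk, w = ⟨0, h0disk⟩ ∨ ∃ z, w = ⟨_, hdisk z⟩ := by
    intro w
    by_cases hw : (w : ℂ) = 0
    · exact Or.inl (Subtype.ext hw)
    · exact Or.inr ⟨lam w, Subtype.ext (hlam w hw).symm⟩
  have hpow : ∀ d : (K ∩ g ⁻¹' e.source : Set Sph), e (g d) = (φ d : ℂ) ^ k := by
    intro d
    rcases hcaseD d with rfl | ⟨z, rfl⟩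
    · rw [hφy, h.zero]; simp [hk.ne']
    · rw [hφF]
      show e (g (F z)) = Complex.exp (z / k) ^ k
      rw [hF.2.2]
      show e (e.symm (Complex.exp z)) = _
      rw [e.right_inv (h.exp_mem z), ← Complex.exp_nat_mul]
      congr 1
      field_simp
  have hφc : Continuous φ := by
    rw [continuous_iff_continuousAt]
    intro d
    rw [ContinuousAt, tendsto_subtype_rng]
    rcases hcaseD d with rfl | ⟨z, rfl⟩
    · rw [hφy]
      have h1 : Tendsto (fun d : (K ∩ g ⁻¹' e.source : Set Sph) => (φ d : ℂ) ^ k) (𝓝 ⟨y, hyD⟩)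
          (𝓝 0) := by
        have : Tendsto (fun d : (K ∩ g ⁻¹' e.source : Set Sph) => e (g d)) (𝓝 ⟨y, hyD⟩)
          (𝓝 (e (g y))) :=
          ((e.continuousAt h.src).tendsto.comp (h.cont.tendsto y)).comp
            (continuous_subtype_val.tendsto (⟨y, hyD⟩ : (K ∩ g ⁻¹' e.source : Set Sph)))
        rw [h.zero] at this
        exact this.congr hpow
      rw [Metric.tendsto_nhds] at h1 ⊢
      intro ε hε
      filter_upwards [h1 (ε ^ k) (by positivity)] with d hd
      rw [dist_zero_right] at hd
      rw [dist_zero_right]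
      rw [norm_pow] at hd
      exact lt_of_pow_lt_pow_left₀ k hε.le hd
    · rw [hφF]
      have h1 : Tendsto (fun z : HP => Complex.exp ((z : ℂ) / k)) (𝓝 z)
          (𝓝 (Complex.exp ((z : ℂ) / k))) := by
        apply Continuous.tendsto
        fun_prop
      intro S hS
      have h2 := h1 hS
      have h3 : F '' ((fun z : HP => Complex.exp ((z : ℂ) / k)) ⁻¹' S) ∈ 𝓝 (F z) :=
        h.lift_open hF z (image_mem_map h2)
      have h4 := (continuous_subtype_val.tendsto
        (⟨F z, hFD z⟩ : (K ∩ g ⁻¹' e.source : Set Sph))) h3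
      rw [Filter.mem_map] at h4 ⊢
      refine Filter.mem_of_superset h4 ?_
      rintro ⟨d, hd⟩ ⟨w, hw, hwd⟩
      simp only at hwd
      subst hwd
      show (φ ⟨F w, hd⟩ : ℂ) ∈ S
      rw [hφF w]
      exact hw
  have hχc : Continuous χ := by
    rw [continuous_iff_continuousAt]
    intro w
    rw [ContinuousAt, tendsto_subtype_rng]
    rcases hcaseW w with rfl | ⟨z, rfl⟩
    · rw [hχ0]
      apply h.fib_tendsto (fun w => (χ w).2.1)
      have h1 : ∀ w : unitDisk, g (χ w) = e.symm ((w : ℂ) ^ k) := by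
        intro w
        rcases hcaseW w with rfl | ⟨z, rfl⟩
        · rw [hχ0]
          simp only [ne_eq, hk.ne', not_false_eq_true, zero_pow]
          rw [← h.zero, e.left_inv h.src]
        · rw [hχe]
          show g (F z) = _
          rw [hF.2.2]
          show e.symm _ = e.symm (Complex.exp (z / k) ^ k)
          rw [← Complex.exp_nat_mul]
          congr 2
          field_simp
      have h0t : (0 : ℂ) ∈ e.target := by rw [h.tgt]; simp
      have h2 : Tendsto (fun w : unitDisk => (w : ℂ) ^ k) (𝓝 ⟨0, h0disk⟩) (𝓝 0) := by
        have : Continuous (fun w : unitDisk => (w : ℂ) ^ k) := by fun_prop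
        have := this.tendsto ⟨0, h0disk⟩
        simpa [hk.ne'] using this
      have h3 := (e.continuousAt_symm h0t).tendsto.comp h2
      rw [show e.symm 0 = g y by rw [← h.zero, e.left_inv h.src]] at h3
      exact h3.congr (fun w => (h1 w).symm)
    · rw [hχe]
      have hop : IsOpenMap (fun z : HP => Complex.exp ((z : ℂ) / k)) := by
        have hm : IsOpenMap (fun z : ℂ => z / k) := by
          have := (Homeomorph.mulRight₀ ((k : ℂ)⁻¹) (inv_ne_zero hkC)).isOpenMap
          simpa [div_eq_mul_inv] using this
        exact (Complex.isOpenMap_exp.comp hm).comp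
          (isOpen_lt Complex.continuous_re continuous_const).isOpenEmbedding_subtypeVal.isOpenMap
      intro S hS
      have h2 := hF.1.continuousAt hS
      have h3 := hop.image_mem_nhds h2
      have h4 := (continuous_subtype_val.tendsto (⟨_, hdisk z⟩ : unitDisk)) h3
      rw [Filter.mem_map] at h4 ⊢
      refine Filter.mem_of_superset h4 ?_
      rintro ⟨d, hd⟩ ⟨w, hw, hwd⟩
      simp only at hwd
      subst hwd
      show (χ ⟨_, hd⟩ : Sph) ∈ S
      rw [hχe w]
      exact hw
  let Φ : (K ∩ g ⁻¹' e.source : Set Sph) ≃ₜ unitDisk :=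
    { toFun := φ
      invFun := χ
      left_inv := fun d => by
        rcases hcaseD d with rfl | ⟨z, rfl⟩
        · rw [hφy, hχ0]
        · rw [hφF, hχe]
      right_inv := fun w => by
        rcases hcaseW w with rfl | ⟨z, rfl⟩
        · rw [hχ0, hφy]
        · rw [hχe, hφF]
      continuous_toFun := hφc
      continuous_invFun := hχc }
  let Ψ : e.source ≃ₜ unitDisk := e.toHomeomorphSourceTarget.trans (Homeomorph.setCongr h.tgt)
  have hΨ : ∀ v : e.source, (Ψ v : ℂ) = e v := fun v => rfl
  refine ⟨k, hk, K ∩ g ⁻¹' e.source, e.source, hyD, h.src, fun z hz => hz.2, hDo, e.open_source,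
    Φ, Ψ, ?_, ?_, ?_⟩
  · exact congrArg Subtype.val hφy
  · rw [hΨ]; exact h.zero
  · intro z
    rw [hΨ]
    exact hpow z

end StoData

theorem stoilow {g : Sph → Sph} (hg : Continuous g) {y : Sph}
    (h1 : ∀ᶠ z in 𝓝[≠] y, ∃ W ∈ 𝓝 z, IsOpen W ∧ InjOn g W ∧ ∀ O ⊆ W, IsOpen O → IsOpen (g '' O))
    (h2 : ∀ᶠ z in 𝓝[≠] y, g z ≠ g y) : ∃ k, IsRamifiedAt g y k := by
  have h3 := eventually_nhdsWithin_iff.1 (h1.and h2)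
  obtain ⟨K, hK, hKs, hKc⟩ := local_compact_nhds h3
  have hcl : IsClosed (g '' (K \ interior K)) :=
    ((hKc.diff isOpen_interior).image hg).isClosed
  have hy : g y ∉ g '' (K \ interior K) := by
    rintro ⟨z, ⟨hz, hz2⟩, hz3⟩
    by_cases hzy : z = y
    · exact hz2 (hzy ▸ mem_interior_iff_mem_nhds.2 hK)
    · exact (hKs hz hzy).2 hz3
  obtain ⟨e, he1, he2, he3, he4⟩ := exists_chart (g y) (hcl.isOpen_compl.mem_nhds hy)
  have : StoData g y K e :=
    { cont := hg
      comp := hKc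
      memK := hK
      fib := fun z hz hzy => by
        by_contra hne
        exact (hKs hz hne).2 hzy
      bd := fun z hz hs => by
        by_contra hcon
        exact he4 hs ⟨z, ⟨hz, fun h' => hcon (mem_interior_iff_mem_nhds.1 h')⟩, rfl⟩
      loc := fun z hz hne _ => (hKs hz hne).1
      tgt := he3
      src := he1
      zero := he2 }
  exact this.ramified


lemma exp_lift_unique {X : Type*} [TopologicalSpace X] [SimplyConnectedSpace X]
    [LocallyPathConnectedSpace X] {L M : X → ℂ} (hL : Continuous L) (hM : Continuous M)
    (h : ∀ x, Complex.exp (L x) = Complex.exp (M x)) {x0 : X} (h0 : L x0 = M x0) : L = M := by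
  obtain ⟨F0, -, hu⟩ := Complex.isCoveringMapOn_exp.existsUnique_continuousMap_lifts
    (⟨fun x => Complex.exp (L x), by fun_prop⟩ : C(X, ℂ)) (a₀ := x0) (e₀ := L x0) rfl
    (fun x => Complex.exp_ne_zero _)
  have h1 := hu ⟨L, hL⟩ ⟨rfl, rfl⟩
  have h2 := hu ⟨M, hM⟩ ⟨h0.symm, funext fun x => (h x).symm⟩
  funext x
  exact DFunLike.congr_fun (h1.trans h2.symm) x

lemma winding {m γ : ℝ → ℂ} (hm : Continuous m) (hγ : Continuous γ) {ρ : ℝ}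
    (hmρ : ∀ s, ‖m s‖ < ρ) (hγ0 : γ 0 = 0) (hγ1 : ‖γ 1‖ = ρ ^ 2)
    (hne : ∀ s t, m s ^ 2 ≠ γ t) : m 1 ≠ - m 0 := by
  intro hm1
  have hsq : m 1 ^ 2 = m 0 ^ 2 := by rw [hm1]; ring
  have hGne : ∀ t s, m s ^ 2 - γ t ≠ 0 := fun t s => sub_ne_zero.2 (hne s t)
  obtain ⟨L, ⟨hL0, hL⟩, -⟩ := Complex.isCoveringMapOn_exp.existsUnique_continuousMap_lifts
    (⟨fun x => m x.2 ^ 2 - γ x.1, by fun_prop⟩ : C(ℝ × ℝ, ℂ))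
    (a₀ := (0, 0)) (e₀ := Complex.log (m 0 ^ 2 - γ 0)) (Complex.exp_log (hGne 0 0))
    (fun x => hGne _ _)
  have hL' : ∀ t s, Complex.exp (L (t, s)) = m s ^ 2 - γ t := fun t s => congrFun hL (t, s)
  have hγ1n : γ 1 ≠ 0 := by
    intro h0
    have h1 := hmρ 0
    have h2 := norm_nonneg (m 0)
    rw [h0] at hγ1
    simp at hγ1
    have : ρ = 0 := by
      simpa using hγ1.symm
    linarith
  have e1 : (fun s => L (1, s)) = fun s => Complex.log (1 - m s ^ 2 / γ 1) +
      (L (1, 0) - Complex.log (1 - m 0 ^ 2 / γ 1)) := by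
    have hre : ∀ s, 0 < (1 - m s ^ 2 / γ 1).re := by
      intro s
      have h1 : ‖m s ^ 2 / γ 1‖ < 1 := by
        rw [norm_div, hγ1, norm_pow]
        have hρ : 0 < ρ := lt_of_le_of_lt (norm_nonneg _) (hmρ s)
        rw [div_lt_one (by positivity)]
        exact pow_lt_pow_left₀ (hmρ s) (norm_nonneg _) (by norm_num)
      have h2 := Complex.re_le_norm (m s ^ 2 / γ 1)
      simp only [Complex.sub_re, Complex.one_re]
      linarith
    have hslit : ∀ s, (1 - m s ^ 2 / γ 1) ∈ Complex.slitPlane := fun s => Or.inl (hre s)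
    have hn : ∀ s, (1 - m s ^ 2 / γ 1) ≠ 0 := fun s => Complex.slitPlane_ne_zero (hslit s)
    have hc : Continuous fun s => Complex.log (1 - m s ^ 2 / γ 1) :=
      Continuous.clog (by fun_prop) hslit
    apply exp_lift_unique (by fun_prop) (by fun_prop) (x0 := 0) _ (by ring)
    intro s
    rw [Complex.exp_add, Complex.exp_sub, Complex.exp_log (hn s), Complex.exp_log (hn 0),
      hL', hL']
    have := hn 0
    have h3 : γ 1 - m 0 ^ 2 ≠ 0 := by
      have := hGne 1 0
      contrapose! this
      rw [← neg_sub, this, neg_zero]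
    field_simp
    ring
  have d1 : L (1, 1) = L (1, 0) := by
    have := congrFun e1 1
    simp only [hsq] at this
    rw [this]; ring
  have e2 : (fun t => L (t, 1)) = fun t => L (t, 0) := by
    apply exp_lift_unique (by fun_prop) (by fun_prop) (x0 := 1) _ d1
    intro t
    rw [hL', hL', hsq]
  have d0 : L (0, 1) = L (0, 0) := congrFun e2 0
  have hm0 : ∀ s, m s ≠ 0 := by
    intro s h
    apply hne s 0
    rw [h, hγ0]; norm_num
  have key := isPreconnected_univ.eq_or_eq_neg_of_sq_eq (f := fun s : ℝ =>
    Complex.exp (L (0, s) / 2)) (g := m) (by fun_prop) (by fun_prop) (by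
      intro s _
      simp only [Pi.pow_apply]
      rw [← Complex.exp_nat_mul]
      push_cast
      rw [mul_div_cancel₀ _ (by norm_num), hL', hγ0, sub_zero]) (fun {s} _ => hm0 s)
  have h10 : m 1 = m 0 := by
    rcases key with h | h
    · rw [← h (mem_univ 1), ← h (mem_univ 0)]
      simp only [d0]
    · have a := h (mem_univ 1)
      have b := h (mem_univ 0)
      simp only [Pi.neg_apply] at a b
      rw [d0] at a
      exact neg_injective (a.symm.trans b)
  rw [h10] at hm1
  have : m 0 = 0 := by
    have : (2 : ℂ) * m 0 = 0 := by
      rw [two_mul]; nth_rw 1 [hm1]; simp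
    simpa using this
  exact hm0 0 this

lemma winding_I {m γ : unitInterval → ℂ} (hm : Continuous m) (hγ : Continuous γ) {ρ : ℝ}
    (hmρ : ∀ s, ‖m s‖ < ρ) (hγ0 : γ 0 = 0) (hγ1 : ‖γ 1‖ = ρ ^ 2)
    (hne : ∀ s t, m s ^ 2 ≠ γ t) : m 1 ≠ - m 0 := by
  have := winding (m := fun s => m (projIcc 0 1 zero_le_one s))
    (γ := fun s => γ (projIcc 0 1 zero_le_one s)) (hm.comp continuous_projIcc)
    (hγ.comp continuous_projIcc) (ρ := ρ) (fun s => hmρ _) (by simpa using hγ0)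
    (by simpa using hγ1) (fun s t => hne _ _)
  simpa using this


lemma oph_of_homeo {U : Set Sph} (hU : IsOpen U) (φ : U ≃ₜ unitDisk) {x : Sph} (hx : x ∈ U) :
    ∃ e : OpenPartialHomeomorph Sph ℂ, e.source = U ∧ e.target = Metric.ball 0 1 ∧
      ∀ z : U, e z = φ z := by
  have hne : Nonempty (⟨U, hU⟩ : TopologicalSpace.Opens Sph) := ⟨⟨x, hx⟩⟩
  have hd : IsOpen unitDisk := Metric.isOpen_ball
  have hne2 : Nonempty (⟨unitDisk, hd⟩ : TopologicalSpace.Opens ℂ) :=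
    ⟨⟨0, by show (0 : ℂ) ∈ Metric.ball 0 1; simp⟩⟩
  let e1 := (⟨U, hU⟩ : TopologicalSpace.Opens Sph).openPartialHomeomorphSubtypeCoe hne
  let e2 := (⟨unitDisk, hd⟩ : TopologicalSpace.Opens ℂ).openPartialHomeomorphSubtypeCoe hne2
  let e3 : OpenPartialHomeomorph (⟨U, hU⟩ : TopologicalSpace.Opens Sph)
    (⟨unitDisk, hd⟩ : TopologicalSpace.Opens ℂ) := Homeomorph.toOpenPartialHomeomorph φ
  refine ⟨(e1.symm.trans e3).trans e2, ?_, ?_, ?_⟩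
  · simp [e1, e2, e3]
  · have t1 : (e1.symm.trans e3).target = univ := by
      rw [OpenPartialHomeomorph.trans_target]
      have : e3.target = univ := rfl
      rw [this]
      simp [e1]
    have t2 : e2.target = unitDisk := by
      simp [e2]
    rw [OpenPartialHomeomorph.trans_target, t1, t2]
    simp [unitDisk]
  · intro z
    have : e1.symm z = z := by
      have := e1.left_inv (x := z) (by simp [e1])
      exact this
    show e2 (e3 (e1.symm z)) = _
    rw [this]
    rfl

lemma ram_form {f : Sph → Sph} {x : Sph} {k : ℕ} (h : IsRamifiedAt f x k) :
    ∃ e1 e2 : OpenPartialHomeomorph Sph ℂ, x ∈ e1.source ∧ e1 x = 0 ∧ e1.target = Metric.ball 0 1 ∧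
      f x ∈ e2.source ∧ e2 (f x) = 0 ∧ e2.target = Metric.ball 0 1 ∧
      ∀ z ∈ e1.source, f z ∈ e2.source ∧ e2 (f z) = e1 z ^ k := by
  obtain ⟨hk, U, V, hx, hfx, hmap, hU, hV, φ, ψ, h1, h2, h3⟩ := h
  obtain ⟨e1, a1, a2, a3⟩ := oph_of_homeo hU φ hx
  obtain ⟨e2, b1, b2, b3⟩ := oph_of_homeo hV ψ hfx
  refine ⟨e1, e2, a1 ▸ hx, ?_, a2, b1 ▸ hfx, ?_, b2, ?_⟩
  · rw [a3 ⟨x, hx⟩, h1]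
  · rw [b3 ⟨f x, hfx⟩, h2]
  · intro z hz
    rw [a1] at hz
    refine ⟨b1 ▸ hmap hz, ?_⟩
    rw [a3 ⟨z, hz⟩, b3 ⟨f z, hmap hz⟩, h3 ⟨z, hz⟩]

lemma finite_of_loc {S : Set Sph} (h : ∀ x, ∃ U ∈ 𝓝 x, ∀ z ∈ U, z ∈ S → z = x) : S.Finite := by
  choose U hU hS using h
  obtain ⟨t, ht⟩ := CompactSpace.elim_nhds_subcover U hU
  refine t.finite_toSet.subset fun z hz => ?_
  have : z ∈ ⋃ x ∈ t, U x := by rw [ht]; trivial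
  obtain ⟨x, hx, hzx⟩ := mem_iUnion₂.1 this
  rw [hS x z hzx hz]
  exact hx

def crit (f : Sph → Sph) : Set Sph := {x | ∀ U ∈ 𝓝 x, ¬ InjOn f U}

lemma pow_open {k : ℕ} (hk : 0 < k) (z : ℂ) : 𝓝 (z ^ k) ≤ map (fun w : ℂ => w ^ k) (𝓝 z) := by
  have ha : AnalyticAt ℂ (fun w : ℂ => w ^ k) z := by fun_prop
  rcases ha.eventually_constant_or_nhds_le_map_nhds with h | h
  · exfalso
    have hfin : {w : ℂ | w ^ k = z ^ k}.Finite := by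
      have : {w : ℂ | w ^ k = z ^ k} ⊆ (Polynomial.nthRoots k (z ^ k)).toFinset := by
        intro w hw
        simp [Polynomial.mem_nthRoots hk]
        exact hw
      exact (Finset.finite_toSet _).subset this
    exact infinite_of_mem_nhds z h hfin
  · exact h

lemma pow_inj {k : ℕ} (hk : 0 < k) {z : ℂ} (hz : z ≠ 0) :
    ∃ W ∈ 𝓝 z, InjOn (fun w : ℂ => w ^ k) W := by
  have h1 : HasStrictDerivAt (fun w : ℂ => w ^ k) ((k : ℂ) * z ^ (k - 1)) z :=
    hasStrictDerivAt_pow k z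
  have hne : (k : ℂ) * z ^ (k - 1) ≠ 0 :=
    mul_ne_zero (by exact_mod_cast hk.ne') (pow_ne_zero _ hz)
  have h2 := h1.hasStrictFDerivAt_equiv hne
  refine ⟨(h2.toOpenPartialHomeomorph _).source,
    (h2.toOpenPartialHomeomorph _).open_source.mem_nhds h2.mem_toOpenPartialHomeomorph_source, ?_⟩
  exact (h2.toOpenPartialHomeomorph _).injOn

section
variable {f : Sph → Sph}

lemma ram_open {x : Sph} {k : ℕ} (h : IsRamifiedAt f x k) : 𝓝 (f x) ≤ map f (𝓝 x) := by
  have hk := h.1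
  obtain ⟨e1, e2, a1, a2, a3, b1, b2, b3, hh⟩ := ram_form h
  intro S hS
  have hS1 : f ⁻¹' S ∩ e1.source ∈ 𝓝 x := inter_mem hS (e1.open_source.mem_nhds a1)
  have h1 : e1.symm ⁻¹' (f ⁻¹' S ∩ e1.source) ∩ e1.target ∈ 𝓝 (e1 x) := by
    refine inter_mem ?_ (e1.open_target.mem_nhds (e1.map_source a1))
    apply e1.continuousAt_symm (e1.map_source a1)
    rwa [e1.left_inv a1]
  have h2 := pow_open hk (e1 x) (image_mem_map h1)
  rw [a2, zero_pow hk.ne', ← b2] at h2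
  filter_upwards [(e2.continuousAt b1) h2, e2.open_source.mem_nhds b1] with v hv hv2
  obtain ⟨w, ⟨⟨hw1, hw2⟩, hw3⟩, hw4⟩ := hv
  have := (hh _ hw2)
  have h5 : f (e1.symm w) = v := by
    apply e2.injOn this.1 hv2
    rw [this.2, e1.right_inv hw3]
    exact hw4
  rw [← h5]; exact hw1

lemma ram_isolated {x : Sph} {k : ℕ} (h : IsRamifiedAt f x k) :
    ∃ U ∈ 𝓝 x, ∀ z ∈ U, f z = f x → z = x := by
  have hk := h.1
  obtain ⟨e1, e2, a1, a2, a3, b1, b2, b3, hh⟩ := ram_form h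
  refine ⟨e1.source, e1.open_source.mem_nhds a1, fun z hz hzx => ?_⟩
  have h1 := (hh z hz).2
  rw [hzx, b2] at h1
  have h2 : e1 z = 0 := by
    by_contra h3
    exact pow_ne_zero k h3 h1.symm
  exact e1.injOn hz a1 (by rw [h2, a2])

lemma ram_locinj {x : Sph} {k : ℕ} (h : IsRamifiedAt f x k) :
    ∃ U ∈ 𝓝 x, ∀ z ∈ U, z ∈ crit f → z = x := by
  have hk := h.1
  obtain ⟨e1, e2, a1, a2, a3, b1, b2, b3, hh⟩ := ram_form h
  refine ⟨e1.source, e1.open_source.mem_nhds a1, fun z hz hzc => ?_⟩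
  by_contra hne
  have hz0 : e1 z ≠ 0 := fun h' => hne (e1.injOn hz a1 (by rw [h', a2]))
  obtain ⟨W, hW, hinj⟩ := pow_inj hk hz0
  refine hzc (e1.source ∩ e1 ⁻¹' W) (inter_mem (e1.open_source.mem_nhds hz)
    (e1.continuousAt hz hW)) ?_
  rintro a ⟨ha, haW⟩ b ⟨hb, hbW⟩ hab
  apply e1.injOn ha hb
  apply hinj haW hbW
  show e1 a ^ k = e1 b ^ k
  rw [← (hh a ha).2, ← (hh b hb).2, hab]

lemma ram_one {x : Sph} (h : IsRamifiedAt f x 1) : x ∉ crit f := by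
  obtain ⟨e1, e2, a1, a2, a3, b1, b2, b3, hh⟩ := ram_form h
  intro hc
  refine hc e1.source (e1.open_source.mem_nhds a1) ?_
  intro a ha b hb hab
  apply e1.injOn ha hb
  rw [← pow_one (e1 a), ← pow_one (e1 b), ← (hh a ha).2, ← (hh b hb).2, hab]

variable (hf : IsRamifiedCovering f)
include hf

lemma IsRamifiedCovering.crit_pt {x : Sph} (h : x ∈ crit f) : IsCriticalPt f x := by
  obtain ⟨k, hk⟩ := hf.2 x
  refine ⟨k, ?_, hk⟩
  have h0 := hk.1
  by_contra h1
  have : k = 1 := by omega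
  subst this
  exact ram_one hk h

lemma IsRamifiedCovering.crit_finite : (crit f).Finite :=
  finite_of_loc fun x => ram_locinj (hf.2 x).choose_spec

lemma IsRamifiedCovering.le_map (x : Sph) : 𝓝 (f x) ≤ map f (𝓝 x) :=
  ram_open (hf.2 x).choose_spec

lemma IsRamifiedCovering.fib_finite (v : Sph) : (f ⁻¹' {v}).Finite := by
  apply finite_of_loc
  intro x
  by_cases hx : f x = v
  · obtain ⟨U, hU, h⟩ := ram_isolated (hf.2 x).choose_spec
    exact ⟨U, hU, fun z hz hz2 => h z hz (hz2.trans hx.symm)⟩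
  · refine ⟨f ⁻¹' {v}ᶜ, hf.1.continuousAt (isOpen_compl_singleton.mem_nhds hx), ?_⟩
    intro z hz hz2
    exact absurd hz2 hz

lemma IsRamifiedCovering.exists_section (x : Sph) :
    ∃ s : Sph → Sph, Tendsto s (𝓝 (f x)) (𝓝 x) ∧ ∀ᶠ v in 𝓝 (f x), f (s v) = v := by
  have hex : ∀ v, ∃ a, (f ⁻¹' {v}).Nonempty → f a = v ∧ ∀ b, f b = v → dist a x ≤ dist b x := by
    intro v
    by_cases hv : (f ⁻¹' {v}).Nonempty
    · obtain ⟨a, ha, hmin⟩ := (isClosed_singleton.preimage hf.1).isCompact.exists_isMinOn hv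
        (f := fun b => dist b x) (by fun_prop)
      exact ⟨a, fun _ => ⟨ha, fun b hb => hmin hb⟩⟩
    · exact ⟨x, fun h => absurd h hv⟩
  choose s hs using hex
  refine ⟨s, ?_, ?_⟩
  · rw [Metric.tendsto_nhds]
    intro ε hε
    have h1 := hf.le_map x (image_mem_map (Metric.ball_mem_nhds x hε))
    filter_upwards [h1] with v hv
    obtain ⟨a, ha, hav⟩ := hv
    exact lt_of_le_of_lt ((hs v ⟨a, hav⟩).2 a hav) ha
  · have h1 := hf.le_map x (image_mem_map (univ_mem))
    filter_upwards [h1] with v hv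
    obtain ⟨a, -, hav⟩ := hv
    exact (hs v ⟨a, hav⟩).1

end


def outS : Set (ℝ × ℝ) := {z | 1 < z.1 ^ 2 + z.2 ^ 2}
def cj (p : ℝ × ℝ) : ℝ × ℝ := (p.1, -p.2)
def rf (p : ℝ × ℝ) : ℝ × ℝ := (-p.1, p.2)

lemma cj_mem {p : ℝ × ℝ} (h : p ∈ circS) : cj p ∈ circS := by
  simp only [circS, mem_ofPred_eq, cj] at h ⊢; rw [← h]; ring
lemma rf_mem {p : ℝ × ℝ} (h : p ∈ circS) : rf p ∈ circS := by
  simp only [circS, mem_ofPred_eq, rf] at h ⊢; rw [← h]; ring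
lemma cj_cj (p : ℝ × ℝ) : cj (cj p) = p := by simp [cj]
lemma rf_rf (p : ℝ × ℝ) : rf (rf p) = p := by simp [rf]
lemma cj_rf (p : ℝ × ℝ) : cj (rf p) = rf (cj p) := by simp [rf, cj]
lemma cj_cont : Continuous cj := by unfold cj; fun_prop
lemma rf_cont : Continuous rf := by unfold rf; fun_prop

lemma alpha_eq {α : ℝ × ℝ → Sph} (h : IsAlphaPath α) {p q : ℝ × ℝ} (hp : p ∈ circS) (hq : q ∈ circS) :
    α p = α q ↔ p = q ∨ p = cj q := by
  rw [h.2 p hp q hq, Prod.ext_iff, Prod.ext_iff]; simp only [cj]; tauto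

lemma beta_eq {α : ℝ × ℝ → Sph} (h : IsBetaPath α) {p q : ℝ × ℝ} (hp : p ∈ circS) (hq : q ∈ circS) :
    α p = α q ↔ p = q ∨ p = rf q := by
  rw [h.2 p hp q hq, Prod.ext_iff, Prod.ext_iff]; simp only [rf]; tauto

lemma alpha_cj {α : ℝ × ℝ → Sph} (h : IsAlphaPath α) {p : ℝ × ℝ} (hp : p ∈ circS) :
    α (cj p) = α p := (alpha_eq h (cj_mem hp) hp).2 (Or.inr rfl)

lemma beta_rf {α : ℝ × ℝ → Sph} (h : IsBetaPath α) {p : ℝ × ℝ} (hp : p ∈ circS) :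
    α (rf p) = α p := (beta_eq h (rf_mem hp) hp).2 (Or.inr rfl)

lemma circS_compact : IsCompact circS := by
  have hc : IsClosed circS := isClosed_eq (by fun_prop) (by fun_prop)
  refine Metric.isCompact_of_isClosed_isBounded hc ?_
  refine (Metric.isBounded_closedBall (x := (0 : ℝ × ℝ)) (r := 1)).subset ?_
  intro p hp
  simp only [circS, mem_ofPred_eq] at hp
  rw [mem_closedBall_zero_iff, Prod.norm_def, max_le_iff, Real.norm_eq_abs, Real.norm_eq_abs]
  constructor <;> apply abs_le_of_sq_le_sq _ zero_le_one <;> nlinarith [sq_nonneg p.1, sq_nonneg p.2]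

lemma pathIm_compact {α : ℝ × ℝ → Sph} (h : ContinuousOn α circS) : IsCompact (pathIm α) :=
  circS_compact.image_of_continuousOn h

lemma outS_open : IsOpen outS := isOpen_lt (by fun_prop) (by fun_prop)

/-- polar coordinates -/
def polc (w : ℂ) : ℝ × ℝ := ((Complex.exp w).re, (Complex.exp w).im)

lemma polc_cont : Continuous polc := by unfold polc; fun_prop
lemma polc_open : IsOpenMap polc :=
  Complex.equivRealProdCLM.toHomeomorph.isOpenMap.comp Complex.isOpenMap_exp
lemma polc_norm (w : ℂ) : (polc w).1 ^ 2 + (polc w).2 ^ 2 = Real.exp w.re ^ 2 := by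
  rw [← Complex.norm_exp, ← Complex.normSq_eq_norm_sq, Complex.normSq_apply]
  simp only [polc]; ring
lemma polc_out (w : ℂ) : polc w ∈ outS ↔ 0 < w.re := by
  simp only [outS, mem_ofPred_eq]
  rw [polc_norm, one_lt_sq_iff₀ (Real.exp_pos _).le, Real.one_lt_exp_iff]
lemma polc_surj {p : ℝ × ℝ} (hp : p ∈ circS) : ∃ w : ℂ, polc w = p ∧ w.re = 0 := by
  have h1 : (⟨p.1, p.2⟩ : ℂ) ≠ 0 := by
    intro h
    have a := congrArg Complex.re h
    have b := congrArg Complex.im h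
    simp only [circS, mem_ofPred_eq] at hp
    simp at a b
    rw [a, b] at hp; norm_num at hp
  have h2 : polc (Complex.log ⟨p.1, p.2⟩) = p := by
    simp [polc, Complex.exp_log h1]
  refine ⟨_, h2, ?_⟩
  have := polc_norm (Complex.log ⟨p.1, p.2⟩)
  rw [h2, show p.1 ^ 2 + p.2 ^ 2 = 1 from hp] at this
  have h3 : Real.exp (Complex.log ⟨p.1, p.2⟩).re = 1 := by
    have := Real.exp_pos (Complex.log ⟨p.1, p.2⟩).re
    nlinarith
  simpa using h3

lemma halfbox {p : ℝ × ℝ} (hp : p ∈ circS) {O : Set (ℝ × ℝ)} (hO : O ∈ 𝓝 p) :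
    ∃ N ⊆ O ∩ outS, IsPathConnected N ∧ IsOpen N ∧ N ∈ 𝓝[outS] p := by
  obtain ⟨w, rfl, hw⟩ := polc_surj hp
  obtain ⟨r, hr, hb⟩ := Metric.mem_nhds_iff.1 (polc_cont.continuousAt hO)
  refine ⟨polc '' (Metric.ball w r ∩ {z | 0 < z.re}), ?_, ?_, ?_, ?_⟩
  · rintro _ ⟨z, ⟨hz1, hz2⟩, rfl⟩
    exact ⟨hb hz1, (polc_out z).2 hz2⟩
  · apply IsPathConnected.image _ polc_cont
    apply Convex.isPathConnected
    · exact (convex_ball _ _).inter (convex_halfSpace_re_gt 0)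
    · refine ⟨w + (r / 2 : ℝ), ?_, ?_⟩
      · simp [abs_of_pos hr]; linarith
      · simp [hw, hr]
  · exact polc_open _ (Metric.isOpen_ball.inter (isOpen_lt (by fun_prop) (by fun_prop)))
  · have h1 := polc_open.image_mem_nhds (Metric.ball_mem_nhds w hr)
    filter_upwards [mem_nhdsWithin_of_mem_nhds h1, self_mem_nhdsWithin] with z hz hz2
    obtain ⟨v, hv, rfl⟩ := hz
    exact ⟨v, ⟨hv, (polc_out v).1 hz2⟩, rfl⟩

lemma out_neBot {p : ℝ × ℝ} (hp : p ∈ circS) : (𝓝[outS] p).NeBot := by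
  rw [← mem_closure_iff_nhdsWithin_neBot, mem_closure_iff_nhds]
  intro O hO
  obtain ⟨N, hN, hc, -⟩ := halfbox hp hO
  exact hc.nonempty.mono hN

lemma coe_deltaBar (z : ℝ × ℝ) : (z : OP) ∈ deltaBar ↔ 1 ≤ z.1 ^ 2 + z.2 ^ 2 := by
  simp [deltaBar]

lemma coe_circOP (z : ℝ × ℝ) : (z : OP) ∈ circOP ↔ z ∈ circS := by
  simp [circOP]

lemma coe_deltaInf (z : ℝ × ℝ) : (z : OP) ∈ deltaInf ↔ z ∈ outS := by
  rw [deltaInf, Set.mem_sdiff, coe_deltaBar, coe_circOP]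
  simp only [outS, circS, mem_ofPred_eq]
  exact ⟨fun h => lt_of_le_of_ne h.1 (Ne.symm h.2), fun h => ⟨h.le, h.ne'⟩⟩

lemma deltaBar_closed : IsClosed deltaBar := by
  have : deltaBar = ((fun p : ℝ × ℝ => (p : OP)) '' {p | p.1 ^ 2 + p.2 ^ 2 < 1})ᶜ := by
    ext w
    induction w using OnePoint.rec with
    | infty => simp [deltaBar]
    | coe z => simp [coe_deltaBar]
  rw [this, isClosed_compl_iff]
  exact OnePoint.isOpenEmbedding_coe.isOpenMap _ (isOpen_lt (by fun_prop) (by fun_prop))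

section
variable {α : ℝ × ℝ → Sph} {ex : OP → Sph} (hα : IsAlphaPath α) (hE : IsExtension α ex)
include hE

lemma E_circ {p : ℝ × ℝ} (hp : p ∈ circS) : ex p = α p := hE.2.1 p hp

lemma E_cont : ContinuousOn (fun z : ℝ × ℝ => ex z) {z | 1 ≤ z.1 ^ 2 + z.2 ^ 2} :=
  hE.1.comp OnePoint.continuous_coe.continuousOn fun z hz => (coe_deltaBar z).2 hz

lemma E_contOut : ContinuousOn (fun z : ℝ × ℝ => ex z) outS :=
  (E_cont hE).mono fun z hz => le_of_lt (show 1 < z.1 ^ 2 + z.2 ^ 2 from hz)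

lemma E_tendsto {p : ℝ × ℝ} (hp : p ∈ circS) :
    Tendsto (fun z : ℝ × ℝ => ex z) (𝓝[outS] p) (𝓝 (α p)) := by
  have h1 := (E_cont hE) p (le_of_eq (Eq.symm hp))
  rw [ContinuousWithinAt, E_circ hE hp] at h1
  exact h1.mono_left (nhdsWithin_mono _ fun z hz => le_of_lt (show 1 < z.1 ^ 2 + z.2 ^ 2 from hz))

lemma E_inj : InjOn (fun z : ℝ × ℝ => ex z) outS := by
  intro a ha b hb hab
  have := hE.2.2.1.injective (a₁ := ⟨a, (coe_deltaInf a).2 ha⟩) (a₂ := ⟨b, (coe_deltaInf b).2 hb⟩) hab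
  simpa using this

lemma E_notin {z : ℝ × ℝ} (hz : z ∈ outS) : ex z ∉ pathIm α := by
  have : ex z ∈ ex '' deltaInf := ⟨z, (coe_deltaInf z).2 hz, rfl⟩
  rw [hE.2.2.2] at this
  exact this

include hα

lemma E_open {O : Set (ℝ × ℝ)} (hO : IsOpen O) (hs : O ⊆ outS) :
    IsOpen ((fun z : ℝ × ℝ => ex z) '' O) := by
  have hr : IsOpen (range (deltaInf.domRestrict ex)) := by
    rw [range_domRestrict, hE.2.2.2]
    exact (pathIm_compact hα.1).isClosed.isOpen_compl
  have hoe : IsOpenEmbedding (deltaInf.domRestrict ex) := ⟨hE.2.2.1, hr⟩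
  have h1 := OnePoint.isOpenEmbedding_coe.isOpenMap _ hO
  have h2 := hoe.isOpenMap _ (h1.preimage continuous_subtype_val)
  convert h2 using 1
  ext x
  constructor
  · rintro ⟨z, hz, rfl⟩
    exact ⟨⟨z, (coe_deltaInf z).2 (hs hz)⟩, ⟨z, hz, rfl⟩, rfl⟩
  · rintro ⟨⟨w, hw⟩, ⟨z, hz, hzw⟩, rfl⟩
    exact ⟨z, hz, by subst hzw; rfl⟩

lemma E_near {p : ℝ × ℝ} (hp : p ∈ circS) {O : Set (ℝ × ℝ)} (hO : IsOpen O) (h1 : p ∈ O)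
    (h2 : cj p ∈ O) :
    ∀ᶠ x in 𝓝 (α p), x ∉ pathIm α → ∃ z ∈ O ∩ outS, ex z = x := by
  let K : Set OP := deltaBar \ ((fun p : ℝ × ℝ => (p : OP)) '' O)
  have hK : IsCompact K :=
    deltaBar_closed.isCompact.diff (OnePoint.isOpenEmbedding_coe.isOpenMap _ hO)
  have hcl : IsClosed (ex '' K) :=
    (hK.image_of_continuousOn (hE.1.mono sdiff_subset)).isClosed
  have hn : α p ∉ ex '' K := by
    rintro ⟨w, ⟨hw1, hw2⟩, hw⟩
    by_cases hc : w ∈ circOP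
    · obtain ⟨q, hq, rfl⟩ := hc
      have h3 : α q = α p := by rw [← E_circ hE hq]; exact hw
      rcases (alpha_eq hα hq hp).1 h3 with rfl | rfl
      · exact hw2 ⟨q, h1, rfl⟩
      · exact hw2 ⟨_, h2, rfl⟩
    · have : ex w ∈ ex '' deltaInf := ⟨w, ⟨hw1, hc⟩, rfl⟩
      rw [hE.2.2.2, hw] at this
      exact this ⟨p, hp, rfl⟩
  filter_upwards [hcl.isOpen_compl.mem_nhds hn] with x hx hx2
  have : x ∈ ex '' deltaInf := by rw [hE.2.2.2]; exact hx2
  obtain ⟨w, hw, rfl⟩ := this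
  have : w ∈ (fun p : ℝ × ℝ => (p : OP)) '' O := by
    by_contra hc
    exact hx ⟨w, ⟨hw.1, hc⟩, rfl⟩
  obtain ⟨z, hz, rfl⟩ := this
  exact ⟨z, ⟨hz, (coe_deltaInf z).1 hw⟩, rfl⟩

lemma lift_out {ι : Type*} (u : Ultrafilter ι) {a : ι → Sph} {p : ℝ × ℝ} (hp : p ∈ circS)
    (ha : Tendsto a u (𝓝 (α p))) (hn : ∀ᶠ i in u, a i ∉ pathIm α) :
    ∃ ζ : ι → ℝ × ℝ, (∀ᶠ i in u, ζ i ∈ outS ∧ ex (ζ i) = a i) ∧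
      (Tendsto ζ u (𝓝[outS] p) ∨ Tendsto ζ u (𝓝[outS] (cj p))) := by
  classical
  let Z : Sph → ℝ × ℝ := fun x => if h : ∃ z ∈ outS, ex z = x then h.choose else 0
  have hZ : ∀ z ∈ outS, Z (ex z) = z := by
    intro z hz
    have h : ∃ w ∈ outS, ex w = ex z := ⟨z, hz, rfl⟩
    simp only [Z, h, dif_pos]
    exact E_inj hE h.choose_spec.1 hz h.choose_spec.2
  refine ⟨fun i => Z (a i), ?_, ?_⟩
  · filter_upwards [ha.eventually (E_near hα hE hp isOpen_univ trivial trivial), hn] with i hi hi2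
    obtain ⟨z, hz, hza⟩ := hi hi2
    rw [← hza, hZ z hz.2]
    exact ⟨hz.2, rfl⟩
  · have : Tendsto (fun i => Z (a i)) u (𝓝[outS] p ⊔ 𝓝[outS] (cj p)) := by
      intro S hS
      obtain ⟨hS1, hS2⟩ := mem_sup.1 hS
      obtain ⟨O1, hO1, hp1, hs1⟩ := mem_nhdsWithin.1 hS1
      obtain ⟨O2, hO2, hp2, hs2⟩ := mem_nhdsWithin.1 hS2
      rw [Filter.mem_map]
      filter_upwards [ha.eventually (E_near hα hE hp (hO1.union hO2) (Or.inl hp1) (Or.inr hp2)),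
        hn] with i hi hi2
      obtain ⟨z, ⟨hz1, hz2⟩, hza⟩ := hi hi2
      show Z (a i) ∈ S
      rw [← hza, hZ z hz2]
      rcases hz1 with h | h
      · exact hs1 ⟨h, hz2⟩
      · exact hs2 ⟨h, hz2⟩
    exact (Ultrafilter.le_sup_iff (u := u.map (fun i => Z (a i)))).1 this

end

lemma famIm_dense {A : Set (ℝ × ℝ → Sph)} {ext : (ℝ × ℝ → Sph) → OP → Sph} (hA : A.Countable)
    (hα : ∀ α ∈ A, IsAlphaPath α) (hE : ∀ α ∈ A, IsExtension α (ext α)) :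
    Dense (famIm A)ᶜ := by
  have : (famIm A)ᶜ = ⋂ α ∈ A, (pathIm α)ᶜ := by simp [famIm]
  rw [this]
  apply dense_biInter_of_isOpen (fun α h => (pathIm_compact (hα α h).1).isClosed.isOpen_compl) hA
  intro α h x
  by_cases hx : x ∈ pathIm α
  · obtain ⟨p, hp, rfl⟩ := hx
    have := out_neBot hp
    apply mem_closure_of_tendsto (E_tendsto (hE α h) hp)
    filter_upwards [self_mem_nhdsWithin] with z hz
    exact E_notin (hE α h) hz
  · exact subset_closure hx


lemma ultra_lim {ι X : Type*} [TopologicalSpace X] [CompactSpace X] (u : Ultrafilter ι) (a : ι → X) :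
    ∃ x, Tendsto a u (𝓝 x) := by
  obtain ⟨x, -, hx⟩ := isCompact_iff_ultrafilter_le_nhds.1 (isCompact_univ (X := X)) (u.map a)
    (by simp)
  exact ⟨x, hx⟩

/-- All the data. -/
structure Reg (A : Set (ℝ × ℝ → Sph)) (ext : (ℝ × ℝ → Sph) → OP → Sph)
    (B : Set (ℝ × ℝ → Sph)) (b : (ℝ × ℝ → Sph) → ℝ × ℝ → Sph) (Φ : Sph → Sph) : Prop where
  data : RegluingData A ext B b
  reg : IsRegluing A ext B b Φ
  count : A.Countable

def Gam (A : Set (ℝ × ℝ → Sph)) (Φ : Sph → Sph) : Set (Sph × Sph) :=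
  closure {q | q.1 ∉ famIm A ∧ q.2 = Φ q.1}

lemma mem_fam {A : Set (ℝ × ℝ → Sph)} {α : ℝ × ℝ → Sph} (hα : α ∈ A) {p : ℝ × ℝ} (hp : p ∈ circS) :
    α p ∈ famIm A := mem_biUnion hα ⟨p, hp, rfl⟩

lemma fam_cases {A : Set (ℝ × ℝ → Sph)} {x : Sph} (h : x ∈ famIm A) :
    ∃ α ∈ A, ∃ p ∈ circS, x = α p := by
  obtain ⟨α, hα, p, hp, rfl⟩ := mem_iUnion₂.1 h
  exact ⟨α, hα, p, hp, rfl⟩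

lemma disj_eq {A : Set (ℝ × ℝ → Sph)} (hA : DisjointPaths A) {α α' : ℝ × ℝ → Sph} (hα : α ∈ A)
    (hα' : α' ∈ A) {p q : ℝ × ℝ} (hp : p ∈ circS) (hq : q ∈ circS) (h : α p = α' q) : α = α' := by
  by_contra hne
  exact Set.disjoint_left.1 (hA hα hα' hne) ⟨p, hp, rfl⟩ ⟨q, hq, h.symm⟩

lemma notin_path {A : Set (ℝ × ℝ → Sph)} {α : ℝ × ℝ → Sph} (hα : α ∈ A) {x : Sph}
    (hx : x ∉ famIm A) : x ∉ pathIm α := fun h => hx (mem_biUnion hα h)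

namespace Reg
variable {A : Set (ℝ × ℝ → Sph)} {ext : (ℝ × ℝ → Sph) → OP → Sph}
    {B : Set (ℝ × ℝ → Sph)} {b : (ℝ × ℝ → Sph) → ℝ × ℝ → Sph} {Φ : Sph → Sph}
    (R : Reg A ext B b Φ)
include R

lemma dense : Dense (famIm A)ᶜ := famIm_dense R.count R.data.alpha R.data.extOk

lemma gam_ultra {x c : Sph} (h : (x, c) ∈ Gam A Φ) :
    ∃ u : Ultrafilter Sph, Tendsto id u (𝓝 x) ∧ (∀ᶠ v in u, v ∉ famIm A) ∧ Tendsto Φ u (𝓝 c) := by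
  obtain ⟨u, hu, hux⟩ := mem_closure_iff_ultrafilter.1 h
  have h1 : Tendsto (fun q : Sph × Sph => q.1) u (𝓝 x) := (continuous_fst.tendsto (x, c)).mono_left hux
  have h2 : Tendsto (fun q : Sph × Sph => q.2) u (𝓝 c) := (continuous_snd.tendsto (x, c)).mono_left hux
  refine ⟨u.map Prod.fst, h1, ?_, ?_⟩
  · show ∀ᶠ v in map Prod.fst (u : Filter (Sph × Sph)), v ∉ famIm A
    rw [eventually_map]
    filter_upwards [hu] with q hq using hq.1
  · show Tendsto Φ (map Prod.fst (u : Filter (Sph × Sph))) _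
    rw [tendsto_map'_iff]
    refine h2.congr' ?_
    filter_upwards [hu] with q hq using hq.2

lemma gam_graph {x : Sph} (h : x ∉ famIm A) : (x, Φ x) ∈ Gam A Φ := subset_closure ⟨h, rfl⟩

lemma gam1 {x c : Sph} (h : (x, c) ∈ Gam A Φ) (hx : x ∉ famIm A) : c = Φ x := by
  obtain ⟨u, h1, h2, h3⟩ := R.gam_ultra h
  have := (R.reg.contOn x hx).mono_left (tendsto_nhdsWithin_iff.2 ⟨h1, h2⟩ : (u : Filter Sph) ≤ _)
  exact tendsto_nhds_unique h3 this

lemma reg_out {α : ℝ × ℝ → Sph} (hα : α ∈ A) {p : ℝ × ℝ} (hp : p ∈ circS) :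
    Tendsto (fun z : ℝ × ℝ => Φ (ext α z)) (𝓝[outS ∩ {z | ext α z ∉ famIm A}] p) (𝓝 (b α p)) := by
  refine (R.reg.tendsto α hα p hp).comp ?_
  refine tendsto_nhdsWithin_iff.2 ⟨?_, ?_⟩
  · exact (OnePoint.continuous_coe.tendsto p).mono_left nhdsWithin_le_nhds
  · filter_upwards [self_mem_nhdsWithin] with z hz
    exact ⟨(coe_deltaInf z).2 hz.1, hz.2⟩

lemma gam_key {α : ℝ × ℝ → Sph} (hα : α ∈ A) {p : ℝ × ℝ} (hp : p ∈ circS) {ι : Type*} {l : Filter ι}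
    {ζ : ι → ℝ × ℝ} (hζ : Tendsto ζ l (𝓝[outS] p)) {c : ι → Sph}
    (hc : ∀ᶠ i in l, (ext α (ζ i), c i) ∈ Gam A Φ) : Tendsto c l (𝓝 (b α p)) := by
  intro V hV
  obtain ⟨V', hV', hcl, hsub⟩ := exists_mem_nhds_isClosed_subset hV
  have h1 := R.reg_out hα hp hV'
  rw [Filter.mem_map] at h1
  obtain ⟨O, hO, hpO, hs⟩ := mem_nhdsWithin.1 h1
  rw [Filter.mem_map]
  filter_upwards [hζ (inter_mem (mem_nhdsWithin_of_mem_nhds (hO.mem_nhds hpO)) self_mem_nhdsWithin),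
    hc] with i hi hi2
  apply hsub
  obtain ⟨u, a1, a2, a3⟩ := R.gam_ultra hi2
  have hop := E_open (R.data.alpha α hα) (R.data.extOk α hα) (hO.inter outS_open) inter_subset_right
  refine hcl.mem_of_tendsto a3 ?_
  filter_upwards [a1 (hop.mem_nhds ⟨ζ i, hi, rfl⟩), a2] with v hv hv2
  obtain ⟨z, hz, hzv⟩ := hv
  simp only at hzv
  rw [← hzv] at hv2 ⊢
  exact hs ⟨hz.1, hz.2, hv2⟩

lemma gam2 {α : ℝ × ℝ → Sph} (hα : α ∈ A) {p : ℝ × ℝ} (hp : p ∈ circS) {c : Sph}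
    (h : (α p, c) ∈ Gam A Φ) : c = b α p ∨ c = b α (cj p) := by
  obtain ⟨u, h1, h2, h3⟩ := R.gam_ultra h
  obtain ⟨ζ, hζ, hor⟩ := lift_out (R.data.alpha α hα) (R.data.extOk α hα) u hp h1
    (h2.mono fun v hv => notin_path hα hv)
  have h4 : ∀ᶠ i in (u : Filter Sph), (ext α (ζ i), Φ i) ∈ Gam A Φ := by
    filter_upwards [h2, hζ] with i hi hi2
    rw [hi2.2]
    exact R.gam_graph hi
  rcases hor with h | h
  · exact Or.inl (tendsto_nhds_unique h3 (R.gam_key hα hp h h4))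
  · exact Or.inr (tendsto_nhds_unique h3 (R.gam_key hα (cj_mem hp) h h4))

lemma meets {O : Set Sph} (hO : IsOpen O) (hne : O.Nonempty) : ∃ x ∈ O, x ∉ famIm A := by
  obtain ⟨x, hx, hx2⟩ := R.dense.inter_open_nonempty O hO hne
  exact ⟨x, hx, hx2⟩

lemma meets_out {α : ℝ × ℝ → Sph} (hα : α ∈ A) {p : ℝ × ℝ} (hp : p ∈ circS) :
    (𝓝[outS ∩ {z | ext α z ∉ famIm A}] p).NeBot := by
  rw [← mem_closure_iff_nhdsWithin_neBot, mem_closure_iff_nhds]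
  intro O hO
  obtain ⟨N, hN, hc, hNo, -⟩ := halfbox hp hO
  have hop := E_open (R.data.alpha α hα) (R.data.extOk α hα) hNo (hN.trans inter_subset_right)
  obtain ⟨x, ⟨z, hz, rfl⟩, hx⟩ := R.meets hop (hc.nonempty.image _)
  exact ⟨z, (hN hz).1, (hN hz).2, hx⟩

lemma gam_ab {α : ℝ × ℝ → Sph} (hα : α ∈ A) {p : ℝ × ℝ} (hp : p ∈ circS) :
    (α p, b α p) ∈ Gam A Φ := by
  have := R.meets_out hα hp
  have h1 := (E_tendsto (R.data.extOk α hα) hp).mono_left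
    (nhdsWithin_mono p (inter_subset_left (t := {z : ℝ × ℝ | ext α z ∉ famIm A})))
  have h2 := R.reg_out hα hp
  refine mem_closure_of_tendsto (h1.prodMk_nhds h2) ?_
  filter_upwards [self_mem_nhdsWithin] with z hz
  exact ⟨hz.2, rfl⟩

lemma gam_ab' {α : ℝ × ℝ → Sph} (hα : α ∈ A) {p : ℝ × ℝ} (hp : p ∈ circS) :
    (α p, b α (cj p)) ∈ Gam A Φ := by
  rw [← alpha_cj (R.data.alpha α hα) hp]
  exact R.gam_ab hα (cj_mem hp)

lemma gam_fst (x : Sph) : ∃ c, (x, c) ∈ Gam A Φ := by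
  by_cases hx : x ∈ famIm A
  · obtain ⟨α, hα, p, hp, rfl⟩ := fam_cases hx
    exact ⟨_, R.gam_ab hα hp⟩
  · exact ⟨_, R.gam_graph hx⟩

lemma b_mem {α : ℝ × ℝ → Sph} (hα : α ∈ A) : b α ∈ B := R.data.bij.mapsTo hα

lemma y_cases (y : Sph) : (∃ x, x ∉ famIm A ∧ y = Φ x) ∨ ∃ α ∈ A, ∃ p ∈ circS, y = b α p := by
  by_cases hy : y ∈ famIm B
  · right
    obtain ⟨β, hβ, p, hp, rfl⟩ := fam_cases hy
    obtain ⟨α, hα, rfl⟩ := R.data.bij.surjOn hβ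
    exact ⟨α, hα, p, hp, rfl⟩
  · left
    obtain ⟨x, hx, rfl⟩ := R.reg.bijOn.surjOn hy
    exact ⟨x, hx, rfl⟩

lemma gam_snd (y : Sph) : ∃ x, (x, y) ∈ Gam A Φ := by
  rcases R.y_cases y with ⟨x, hx, rfl⟩ | ⟨α, hα, p, hp, rfl⟩
  · exact ⟨x, R.gam_graph hx⟩
  · exact ⟨_, R.gam_ab hα hp⟩

lemma phi_ne {x : Sph} (hx : x ∉ famIm A) {α : ℝ × ℝ → Sph} (hα : α ∈ A) {p : ℝ × ℝ}
    (hp : p ∈ circS) : Φ x ≠ b α p := by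
  intro h
  have := R.reg.bijOn.mapsTo (show x ∈ (famIm A)ᶜ from hx)
  rw [h] at this
  exact this (mem_fam (R.b_mem hα) hp)

lemma gam3 {x x0 : Sph} (hx0 : x0 ∉ famIm A) (h : (x, Φ x0) ∈ Gam A Φ) : x = x0 := by
  by_cases hx : x ∈ famIm A
  · obtain ⟨α, hα, p, hp, rfl⟩ := fam_cases hx
    rcases R.gam2 hα hp h with h | h
    · exact absurd h (R.phi_ne hx0 hα hp)
    · exact absurd h (R.phi_ne hx0 hα (cj_mem hp))
  · exact (R.reg.bijOn.injOn (show x0 ∈ (famIm A)ᶜ from hx0) (show x ∈ (famIm A)ᶜ from hx)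
      (R.gam1 h hx)).symm

lemma b_eq {α α' : ℝ × ℝ → Sph} (hα : α ∈ A) (hα' : α' ∈ A) {p q : ℝ × ℝ} (hp : p ∈ circS)
    (hq : q ∈ circS) (h : b α p = b α' q) : α = α' ∧ (p = q ∨ p = rf q) := by
  have h1 := disj_eq R.data.disjB (R.b_mem hα) (R.b_mem hα') hp hq h
  have h2 := R.data.bij.injOn hα hα' h1
  subst h2
  exact ⟨rfl, (beta_eq (R.data.beta _ (R.b_mem hα)) hp hq).1 h⟩

lemma b_rf {α : ℝ × ℝ → Sph} (hα : α ∈ A) {p : ℝ × ℝ} (hp : p ∈ circS) : b α (rf p) = b α p :=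
  beta_rf (R.data.beta _ (R.b_mem hα)) hp

lemma gam4 {x : Sph} {α : ℝ × ℝ → Sph} (hα : α ∈ A) {p : ℝ × ℝ} (hp : p ∈ circS)
    (h : (x, b α p) ∈ Gam A Φ) : x = α p ∨ x = α (rf p) := by
  by_cases hx : x ∈ famIm A
  · obtain ⟨α', hα', q, hq, rfl⟩ := fam_cases hx
    rcases R.gam2 hα' hq h with h | h
    · obtain ⟨rfl, h2⟩ := R.b_eq hα hα' hp hq h
      rcases h2 with rfl | rfl
      · exact Or.inl rfl
      · rw [rf_rf]; exact Or.inr rfl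
    · obtain ⟨rfl, h2⟩ := R.b_eq hα hα' hp (cj_mem hq) h
      rw [← alpha_cj (R.data.alpha α hα) hq]
      rcases h2 with rfl | rfl
      · exact Or.inl rfl
      · rw [rf_rf]; exact Or.inr rfl
  · exact absurd (R.gam1 h hx).symm (R.phi_ne hx hα hp)

lemma gam_lim {ι : Type*} {l : Filter ι} [l.NeBot] {a c : ι → Sph} {x y : Sph}
    (ha : Tendsto a l (𝓝 x)) (hc : Tendsto c l (𝓝 y)) (h : ∀ᶠ i in l, (a i, c i) ∈ Gam A Φ) :
    (x, y) ∈ Gam A Φ := isClosed_closure.mem_of_tendsto (ha.prodMk_nhds hc) h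

lemma gam_tendsto {ι : Type*} {l : Filter ι} {a c : ι → Sph} {x y : Sph}
    (ha : Tendsto a l (𝓝 x)) (h : ∀ᶠ i in l, (a i, c i) ∈ Gam A Φ)
    (hu : ∀ z, (x, z) ∈ Gam A Φ → z = y) : Tendsto c l (𝓝 y) := by
  rw [tendsto_iff_ultrafilter]
  intro u hul
  obtain ⟨z, hz⟩ := ultra_lim u c
  have := hu z (R.gam_lim (ha.mono_left hul) hz (hul h))
  rw [← this]
  exact hz

lemma denseB : Dense (famIm B)ᶜ := by
  intro y
  rcases R.y_cases y with ⟨x, hx, rfl⟩ | ⟨α, hα, p, hp, rfl⟩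
  · exact subset_closure (R.reg.bijOn.mapsTo (show x ∈ (famIm A)ᶜ from hx))
  · obtain ⟨u, h1, h2, h3⟩ := R.gam_ultra (R.gam_ab hα hp)
    refine mem_closure_of_tendsto h3 ?_
    filter_upwards [h2] with x hx
    exact R.reg.bijOn.mapsTo (show x ∈ (famIm A)ᶜ from hx)

end Reg


def Csg (h X : ℝ × ℝ → Sph) : Set ((ℝ × ℝ) × (ℝ × ℝ)) :=
  closure {q | q.1 ∈ outS ∧ q.2 ∈ outS ∧ h q.1 = X q.2}

lemma csg_or {h X : ℝ × ℝ → Sph} {p q1 q2 : ℝ × ℝ} (hp : p ∈ circS)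
    (hnear : ∀ O1 ∈ 𝓝 q1, ∀ O2 ∈ 𝓝 q2, ∀ᶠ z in 𝓝[outS] p,
      h z ∈ X '' (O1 ∩ outS) ∪ X '' (O2 ∩ outS)) :
    (p, q1) ∈ Csg h X ∨ (p, q2) ∈ Csg h X := by
  by_contra hcon
  push Not at hcon
  obtain ⟨h1, h2⟩ := hcon
  have key : ∀ q, (p, q) ∉ Csg h X → ∃ P ∈ 𝓝 p, ∃ O ∈ 𝓝 q, ∀ z ∈ P ∩ outS, h z ∉ X '' (O ∩ outS) := by
    intro q hq
    have := (isClosed_closure (s := {q : (ℝ × ℝ) × (ℝ × ℝ) |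
      q.1 ∈ outS ∧ q.2 ∈ outS ∧ h q.1 = X q.2})).isOpen_compl.mem_nhds hq
    rw [mem_nhds_prod_iff] at this
    obtain ⟨P, hP, O, hO, hs⟩ := this
    refine ⟨P, hP, O, hO, ?_⟩
    rintro z ⟨hz, hz2⟩ ⟨w, ⟨hw, hw2⟩, hwz⟩
    exact hs (show (z, w) ∈ P ×ˢ O from ⟨hz, hw⟩) (subset_closure ⟨hz2, hw2, hwz.symm⟩)
  obtain ⟨P1, hP1, O1, hO1, k1⟩ := key q1 h1
  obtain ⟨P2, hP2, O2, hO2, k2⟩ := key q2 h2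
  have := out_neBot hp
  have e1 : ∀ᶠ z in 𝓝[outS] p, z ∈ P1 := mem_nhdsWithin_of_mem_nhds hP1
  have e2 : ∀ᶠ z in 𝓝[outS] p, z ∈ P2 := mem_nhdsWithin_of_mem_nhds hP2
  have e3 : ∀ᶠ z in 𝓝[outS] p, z ∈ outS := self_mem_nhdsWithin
  obtain ⟨z, hz, hz1, hz2, hz3⟩ := ((hnear O1 hO1 O2 hO2).and (e1.and (e2.and e3))).exists
  rcases hz with hz | hz
  · exact k1 z ⟨hz1, hz3⟩ hz
  · exact k2 z ⟨hz2, hz3⟩ hz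

lemma csg_not {h X : ℝ × ℝ → Sph} {p q1 q2 : ℝ × ℝ} (hp : p ∈ circS) (hh : ContinuousOn h outS)
    (hX : ∀ O ⊆ outS, IsOpen O → IsOpen (X '' O))
    (hnear : ∀ O1 ∈ 𝓝 q1, ∀ O2 ∈ 𝓝 q2, ∀ᶠ z in 𝓝[outS] p,
      h z ∈ X '' (O1 ∩ outS) ∪ X '' (O2 ∩ outS))
    (hdis : ∃ O1 ∈ 𝓝 q1, ∃ O2 ∈ 𝓝 q2, Disjoint (X '' (O1 ∩ outS)) (X '' (O2 ∩ outS))) :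
    ¬ ((p, q1) ∈ Csg h X ∧ (p, q2) ∈ Csg h X) := by
  obtain ⟨O1', hO1', O2', hO2', hd'⟩ := hdis
  obtain ⟨O1, hs1, hO1, hq1⟩ := mem_nhds_iff.1 hO1'
  obtain ⟨O2, hs2, hO2, hq2⟩ := mem_nhds_iff.1 hO2'
  have hd : Disjoint (X '' (O1 ∩ outS)) (X '' (O2 ∩ outS)) :=
    hd'.mono (image_mono (inter_subset_inter_left _ hs1)) (image_mono (inter_subset_inter_left _ hs2))
  have hn := hnear O1 (hO1.mem_nhds hq1) O2 (hO2.mem_nhds hq2)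
  obtain ⟨P, hP, hpP, hPs⟩ := mem_nhdsWithin.1 hn
  obtain ⟨N, hN, hNc, hNo, hNn⟩ := halfbox hp (hP.mem_nhds hpP)
  have hsub : h '' N ⊆ X '' (O1 ∩ outS) ∪ X '' (O2 ∩ outS) := by
    rintro _ ⟨z, hz, rfl⟩
    exact hPs (hN hz)
  have hpre : IsPreconnected (h '' N) :=
    hNc.isConnected.isPreconnected.image h (hh.mono (hN.trans inter_subset_right))
  have key : ∀ q, ∀ O, IsOpen O → q ∈ O → (p, q) ∈ Csg h X → (h '' N ∩ X '' (O ∩ outS)).Nonempty := by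
    intro q O hO hqO hc
    obtain ⟨V, hV, hpV, hVs⟩ := mem_nhdsWithin.1 hNn
    obtain ⟨⟨z, w⟩, hzw, h1, h2, h3⟩ := mem_closure_iff.1 hc (V ×ˢ O) (hV.prod hO) ⟨hpV, hqO⟩
    exact ⟨h z, ⟨z, hVs ⟨hzw.1, h1⟩, rfl⟩, ⟨w, ⟨hzw.2, h2⟩, h3.symm⟩⟩
  rintro ⟨c1, c2⟩
  obtain ⟨x, -, hx1, hx2⟩ := hpre _ _ (hX _ inter_subset_right (hO1.inter outS_open))
    (hX _ inter_subset_right (hO2.inter outS_open)) hsub (key q1 O1 hO1 hq1 c1) (key q2 O2 hO2 hq2 c2)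
  exact Set.disjoint_left.1 hd hx1 hx2

lemma csg_const {D : Set ((ℝ × ℝ) × (ℝ × ℝ))} (hD : IsClosed D) {P Q1 Q2 : ℝ → ℝ × ℝ}
    (hP : Continuous P) (h1 : Continuous Q1) (h2 : Continuous Q2) {J : Set ℝ}
    (hJ : IsPreconnected J)
    (hor : ∀ t ∈ J, (P t, Q1 t) ∈ D ∨ (P t, Q2 t) ∈ D)
    (hnot : ∀ t ∈ J, ¬ ((P t, Q1 t) ∈ D ∧ (P t, Q2 t) ∈ D)) :
    (∀ t ∈ J, (P t, Q1 t) ∈ D) ∨ (∀ t ∈ J, (P t, Q2 t) ∈ D) := by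
  by_contra hcon
  push Not at hcon
  obtain ⟨⟨t, ht, ht1⟩, ⟨s, hs, hs1⟩⟩ := hcon
  have hc1 : IsClosed {t | (P t, Q1 t) ∈ D} := hD.preimage (hP.prodMk h1)
  have hc2 : IsClosed {t | (P t, Q2 t) ∈ D} := hD.preimage (hP.prodMk h2)
  obtain ⟨r, hr, hr1, hr2⟩ := isPreconnected_closed_iff.1 hJ _ _ hc1 hc2 (fun r hr => hor r hr)
    ⟨s, hs, (hor s hs).resolve_right hs1⟩ ⟨t, ht, (hor t ht).resolve_left ht1⟩
  exact hnot r hr ⟨hr1, hr2⟩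

/-- parametrised half circles -/
def arcq (σ θ : ℝ) : ℝ × ℝ := (Real.sin θ, σ * Real.cos θ)

lemma arcq_cont (σ : ℝ) : Continuous (arcq σ) := by unfold arcq; fun_prop
lemma arcq_mem {σ : ℝ} (hσ : σ ^ 2 = 1) (θ : ℝ) : arcq σ θ ∈ circS := by
  simp only [circS, arcq, mem_ofPred_eq, mul_pow, hσ]
  linarith [Real.sin_sq_add_cos_sq θ]
lemma arcq_rf (σ θ : ℝ) : rf (arcq σ θ) = arcq σ (-θ) := by simp [rf, arcq]
lemma arcq_zero (σ : ℝ) : arcq σ 0 = (0, σ) := by simp [arcq]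
lemma exists_arcq {p : ℝ × ℝ} (hp : p ∈ circS) (h2 : p.2 ≠ 0) :
    ∃ σ θ : ℝ, σ ^ 2 = 1 ∧ θ ∈ Ioo (-(Real.pi / 2)) (Real.pi / 2) ∧ p = arcq σ θ ∧
      (0 < p.1 → 0 < θ) := by
  have hp' : p.1 ^ 2 + p.2 ^ 2 = 1 := hp
  have h2' : 0 < p.2 ^ 2 := by positivity
  have hlt : -1 < p.1 ∧ p.1 < 1 := abs_lt.1 (abs_lt_of_sq_lt_sq (by linarith) zero_le_one)
  have hcos : Real.cos (Real.arcsin p.1) = |p.2| := by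
    rw [Real.cos_arcsin, show 1 - p.1 ^ 2 = p.2 ^ 2 by linarith, Real.sqrt_sq_eq_abs]
  have hsin : Real.sin (Real.arcsin p.1) = p.1 := Real.sin_arcsin hlt.1.le hlt.2.le
  have hth : Real.arcsin p.1 ∈ Ioo (-(Real.pi / 2)) (Real.pi / 2) :=
    ⟨Real.neg_pi_div_two_lt_arcsin.2 hlt.1, Real.arcsin_lt_pi_div_two.2 hlt.2⟩
  rcases lt_or_gt_of_ne h2 with h | h
  · refine ⟨-1, Real.arcsin p.1, by norm_num, hth, ?_, fun h => Real.arcsin_pos.2 h⟩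
    rw [arcq, hcos, hsin, abs_of_neg h]; simp
  · refine ⟨1, Real.arcsin p.1, by norm_num, hth, ?_, fun h => Real.arcsin_pos.2 h⟩
    rw [arcq, hcos, hsin, abs_of_pos h]; simp

lemma arc_near {u v : ℝ × ℝ → Sph} (hu : ContinuousOn u circS) (hv : ContinuousOn v circS)
    {x : Sph} {U : Set Sph} (hU : IsOpen U) (h : ∀ r ∈ circS, v r = x → u r ∈ U) :
    ∀ᶠ y in 𝓝 x, ∀ r ∈ circS, v r = y → u r ∈ U := by
  obtain ⟨C, hC, hCe⟩ := continuousOn_iff_isClosed.1 hu Uᶜ hU.isClosed_compl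
  have hK : IsCompact (circS ∩ C) := circS_compact.inter_right hC
  have hcl : IsClosed (v '' (circS ∩ C)) := (hK.image_of_continuousOn (hv.mono inter_subset_left)).isClosed
  have hmem : ∀ r ∈ circS, r ∈ C → u r ∉ U := fun r hr hrC => by
    have : r ∈ C ∩ circS := ⟨hrC, hr⟩
    rw [← hCe] at this
    exact this.1
  have hn : x ∉ v '' (circS ∩ C) := by
    rintro ⟨r, ⟨hr, hrC⟩, hrx⟩
    exact hmem r hr hrC (h r hr hrx)
  filter_upwards [hcl.isOpen_compl.mem_nhds hn] with y hy r hr hry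
  by_contra hc
  have : r ∈ u ⁻¹' Uᶜ ∩ circS := ⟨hc, hr⟩
  rw [hCe] at this
  exact hy ⟨r, ⟨hr, this.1⟩, hry⟩

def Ty2 (f : Sph → Sph) (A : Set (ℝ × ℝ → Sph)) (α : ℝ × ℝ → Sph) : Prop :=
  (∀ p ∈ circS, f (α p) = f (α (rf p))) ∧ Disjoint (f '' pathIm α) (famIm A)

lemma inj_nhd {f : Sph → Sph} {x : Sph} (h : x ∉ crit f) : ∃ U, IsOpen U ∧ x ∈ U ∧ InjOn f U := by
  simp only [crit, mem_ofPred_eq, not_forall, not_not] at h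
  obtain ⟨U, hU, hi⟩ := h
  obtain ⟨V, hVU, hV, hx⟩ := mem_nhds_iff.1 hU
  exact ⟨V, hV, hx, hi.mono hVU⟩

section
variable {A : Set (ℝ × ℝ → Sph)} {ext : (ℝ × ℝ → Sph) → OP → Sph}
    {B : Set (ℝ × ℝ → Sph)} {b : (ℝ × ℝ → Sph) → ℝ × ℝ → Sph} {Φ : Sph → Sph} {f : Sph → Sph}

lemma nc1 (hf : IsRamifiedCovering f) (hS : StronglyFStable f A) (R : Reg A ext B b Φ) {α α' : ℝ × ℝ → Sph}
    (hα : α ∈ A) (hα' : α' ∈ A) (h : ∀ p ∈ circS, f (α p) = α' p) {p : ℝ × ℝ} (hp : p ∈ circS) :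
    α p ∉ crit f := by
  intro hc
  obtain ⟨-, α'', h1, h2, h3⟩ := hS.2 _ (mem_fam hα hp) (hf.crit_pt hc)
  have h01 : ((0, 1) : ℝ × ℝ) ∈ circS := by simp [circS]
  have h10 : ((1, 0) : ℝ × ℝ) ∈ circS := by simp [circS]
  have h10' : ((-1, 0) : ℝ × ℝ) ∈ circS := by simp [circS]
  have := disj_eq R.data.disjA hα h1 hp h01 h2
  subst this
  have h4 := h3 _ h10
  simp only at h4
  rw [h _ h10, h _ h10'] at h4
  have := ((R.data.alpha _ hα').2 _ h10 _ h10').1 h4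
  norm_num at this

lemma nc2 (hf : IsRamifiedCovering f) (hS : StronglyFStable f A) (R : Reg A ext B b Φ) {α : ℝ × ℝ → Sph}
    (hα : α ∈ A) {p : ℝ × ℝ} (hp : p ∈ circS) (hp1 : p.1 ≠ 0) :
    α p ∉ crit f := by
  intro hc
  obtain ⟨-, α'', h1, h2, h3⟩ := hS.2 _ (mem_fam hα hp) (hf.crit_pt hc)
  have h01 : ((0, 1) : ℝ × ℝ) ∈ circS := by simp [circS]
  have := disj_eq R.data.disjA hα h1 hp h01 h2
  subst this
  exact hp1 (((R.data.alpha _ hα).2 _ hp _ h01).1 h2).1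

lemma arcq_tendsto {α : ℝ × ℝ → Sph} (hα : ContinuousOn α circS) {σ : ℝ} (hσ : σ ^ 2 = 1) :
    Continuous (fun t => α (arcq σ t)) :=
  hα.comp_continuous (arcq_cont σ) (arcq_mem hσ)

lemma c2 (hf : IsRamifiedCovering f) (hS : StronglyFStable f A) (R : Reg A ext B b Φ) {α : ℝ × ℝ → Sph}
    (hα : α ∈ A) (h : Ty2 f A α) : α (0, 1) ∈ crit f ∧ IsRamifiedAt f (α (0, 1)) 2 := by
  have h01 : ((0, 1) : ℝ × ℝ) ∈ circS := by simp [circS]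
  have hc : α (0, 1) ∈ crit f := by
    intro U hU hinj
    have hσ : (1 : ℝ) ^ 2 = 1 := by norm_num
    have hct := arcq_tendsto (R.data.alpha α hα).1 hσ
    have h1 : ∀ᶠ t in 𝓝 (0 : ℝ), α (arcq 1 t) ∈ U := by
      apply hct.continuousAt
      show U ∈ 𝓝 (α (arcq 1 0))
      rw [arcq_zero]; exact hU
    have h2 : ∀ᶠ t in 𝓝 (0 : ℝ), α (arcq 1 (-t)) ∈ U := by
      apply (hct.comp continuous_neg).continuousAt
      simp only [Function.comp, neg_zero]
      rw [arcq_zero]; exact hU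
    have e : ∀ᶠ t in 𝓝[>] (0 : ℝ), t ∈ Ioo 0 Real.pi := Ioo_mem_nhdsGT Real.pi_pos
    have e' : ∀ᶠ t in 𝓝[>] (0 : ℝ), α (arcq 1 t) ∈ U ∧ α (arcq 1 (-t)) ∈ U :=
      (h1.and h2).filter_mono nhdsWithin_le_nhds
    obtain ⟨t, ht, ht1, ht2⟩ := (e'.and e).exists
    have h3 := hinj ht.1 ht.2 (by rw [h.1 _ (arcq_mem hσ t), arcq_rf])
    have h4 := (((R.data.alpha _ hα).2 _ (arcq_mem hσ _) _ (arcq_mem hσ _)).1 h3).1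
    have h5 := Real.sin_pos_of_pos_of_lt_pi ht1 ht2
    simp only [arcq, Real.sin_neg] at h4
    linarith
  exact ⟨hc, (hS.2 _ (mem_fam hα h01) (hf.crit_pt hc)).1⟩

end


section
variable {A : Set (ℝ × ℝ → Sph)} {ext : (ℝ × ℝ → Sph) → OP → Sph}
    {B : Set (ℝ × ℝ → Sph)} {b : (ℝ × ℝ → Sph) → ℝ × ℝ → Sph} {Φ : Sph → Sph} {f : Sph → Sph}

/-- sign set for type one -/
def C1 (f : Sph → Sph) (ext : (ℝ × ℝ → Sph) → OP → Sph) (α α' : ℝ × ℝ → Sph) :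
    Set ((ℝ × ℝ) × (ℝ × ℝ)) := Csg (fun z => f (ext α z)) (fun z => ext α' z)
/-- sign set for type two -/
def C2 (f : Sph → Sph) (ext : (ℝ × ℝ → Sph) → OP → Sph) (α : ℝ × ℝ → Sph) :
    Set ((ℝ × ℝ) × (ℝ × ℝ)) := Csg (fun z => f (ext α z)) (fun z => f (ext α z))

lemma near1 (hf : IsRamifiedCovering f) (hS : StronglyFStable f A) (R : Reg A ext B b Φ)
    {α α' : ℝ × ℝ → Sph} (hα : α ∈ A) (hα' : α' ∈ A) (h : ∀ p ∈ circS, f (α p) = α' p)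
    {p : ℝ × ℝ} (hp : p ∈ circS) : ∀ O1 ∈ 𝓝 p, ∀ O2 ∈ 𝓝 (cj p), ∀ᶠ z in 𝓝[outS] p,
      (fun z : ℝ × ℝ => f (ext α z)) z ∈ (fun z : ℝ × ℝ => ext α' z) '' (O1 ∩ outS) ∪
        (fun z : ℝ × ℝ => ext α' z) '' (O2 ∩ outS) := by
  intro O1 hO1 O2 hO2
  have ha := R.data.alpha α hα
  have ha' := R.data.alpha α' hα'
  have hE := R.data.extOk α hα
  have hE' := R.data.extOk α' hα'
  obtain ⟨U, hU, hpU, hinj⟩ := inj_nhd (nc1 hf hS R hα hα' h hp)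
  have h1 : ∀ᶠ y in 𝓝 (α' p), ∀ r ∈ circS, α' r = y → α r ∈ U := by
    apply arc_near ha.1 ha'.1 hU
    intro r hr hrp
    rw [(alpha_eq ha hr hp).2 ((alpha_eq ha' hr hp).1 hrp)]
    exact hpU
  have h2 := E_near ha' hE' hp (O := interior O1 ∪ interior O2)
    (isOpen_interior.union isOpen_interior)
    (Or.inl (mem_interior_iff_mem_nhds.2 hO1)) (Or.inr (mem_interior_iff_mem_nhds.2 hO2))
  have h3 := E_tendsto hE hp
  have h4 : Tendsto (fun z : ℝ × ℝ => f (ext α z)) (𝓝[outS] p) (𝓝 (α' p)) := by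
    rw [← h p hp]; exact (hf.1.tendsto _).comp h3
  filter_upwards [h4.eventually h1, h4.eventually h2, h3 (hU.mem_nhds hpU), self_mem_nhdsWithin]
    with z k1 k2 k3 k4
  have : f (ext α z) ∉ pathIm α' := by
    rintro ⟨r, hr, hrz⟩
    have := hinj (k1 r hr hrz) k3 (by rw [h r hr, hrz])
    exact E_notin hE k4 ⟨r, hr, this⟩
  obtain ⟨w, ⟨hw, hw2⟩, hwz⟩ := k2 this
  rcases hw with hw | hw
  · exact Or.inl ⟨w, ⟨interior_subset hw, hw2⟩, hwz⟩
  · exact Or.inr ⟨w, ⟨interior_subset hw, hw2⟩, hwz⟩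

lemma cj_ne {p : ℝ × ℝ} (h : p.2 ≠ 0) : p ≠ cj p := by
  intro h'
  have := congrArg Prod.snd h'
  simp only [cj] at this
  apply h; linarith

lemma not1 (hf : IsRamifiedCovering f) (hS : StronglyFStable f A) (R : Reg A ext B b Φ)
    {α α' : ℝ × ℝ → Sph} (hα : α ∈ A) (hα' : α' ∈ A) (h : ∀ p ∈ circS, f (α p) = α' p)
    {p : ℝ × ℝ} (hp : p ∈ circS) (hp2 : p.2 ≠ 0) :
    ¬ ((p, p) ∈ C1 f ext α α' ∧ (p, cj p) ∈ C1 f ext α α') := by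
  have ha' := R.data.alpha α' hα'
  have hE := R.data.extOk α hα
  have hE' := R.data.extOk α' hα'
  apply csg_not hp (hf.1.comp_continuousOn (E_contOut hE)) (fun O hs hO => E_open ha' hE' hO hs)
    (near1 hf hS R hα hα' h hp)
  obtain ⟨O1, O2, hO1, hO2, m1, m2, hd⟩ := t2_separation (cj_ne hp2)
  refine ⟨O1, hO1.mem_nhds m1, O2, hO2.mem_nhds m2, ?_⟩
  rw [Set.disjoint_left]
  rintro _ ⟨z, ⟨hz, hz'⟩, rfl⟩ ⟨w, ⟨hw, hw'⟩, hwz⟩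
  have := E_inj hE' hw' hz' hwz
  rw [this] at hw
  exact Set.disjoint_left.1 hd hz hw

lemma arcq_two_ne {σ θ : ℝ} (hσ : σ ^ 2 = 1) (h : θ ∈ Ioo (-(Real.pi / 2)) (Real.pi / 2)) :
    (arcq σ θ).2 ≠ 0 := by
  have : σ ≠ 0 := by rintro rfl; norm_num at hσ
  exact mul_ne_zero this (Real.cos_pos_of_mem_Ioo h).ne'

lemma sgn1 (hf : IsRamifiedCovering f) (hS : StronglyFStable f A) (R : Reg A ext B b Φ)
    {α α' : ℝ × ℝ → Sph} (hα : α ∈ A) (hα' : α' ∈ A) (h : ∀ p ∈ circS, f (α p) = α' p)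
    {p : ℝ × ℝ} (hp : p ∈ circS) (hp2 : p.2 ≠ 0)
    (c1 : (p, p) ∈ C1 f ext α α' ∨ (rf p, rf p) ∈ C1 f ext α α')
    (c2 : (p, cj p) ∈ C1 f ext α α' ∨ (rf p, cj (rf p)) ∈ C1 f ext α α') : False := by
  obtain ⟨σ, θ, hσ, hθ, hpe, -⟩ := exists_arcq hp hp2
  have hnot : ∀ t ∈ Ioo (-(Real.pi / 2)) (Real.pi / 2), ¬ ((arcq σ t, arcq σ t) ∈ C1 f ext α α' ∧
      (arcq σ t, cj (arcq σ t)) ∈ C1 f ext α α') := fun t ht =>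
    not1 hf hS R hα hα' h (arcq_mem hσ t) (arcq_two_ne hσ ht)
  have hconst := csg_const (D := C1 f ext α α') isClosed_closure (P := arcq σ) (Q1 := arcq σ)
    (Q2 := fun t => cj (arcq σ t)) (arcq_cont σ) (arcq_cont σ) (cj_cont.comp (arcq_cont σ))
    (J := Ioo (-(Real.pi / 2)) (Real.pi / 2)) isPreconnected_Ioo
    (fun t ht => csg_or (arcq_mem hσ t) (near1 hf hS R hα hα' h (arcq_mem hσ t))) hnot
  have hθ' : -θ ∈ Ioo (-(Real.pi / 2)) (Real.pi / 2) := ⟨by linarith [hθ.2], by linarith [hθ.1]⟩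
  rw [hpe, arcq_rf] at c1 c2
  rcases hconst with hc | hc
  · rcases c2 with k | k
    · exact hnot _ hθ ⟨hc _ hθ, k⟩
    · exact hnot _ hθ' ⟨hc _ hθ', k⟩
  · rcases c1 with k | k
    · exact hnot _ hθ ⟨k, hc _ hθ⟩
    · exact hnot _ hθ' ⟨k, hc _ hθ'⟩

lemma rf_cases {r p : ℝ × ℝ} (h : r = rf p ∨ r = cj (rf p)) : rf r = p ∨ rf r = cj p := by
  rcases h with rfl | rfl
  · left; exact rf_rf p
  · right; rw [cj_rf, rf_rf]

lemma near2 (hf : IsRamifiedCovering f) (hS : StronglyFStable f A) (R : Reg A ext B b Φ)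
    {α : ℝ × ℝ → Sph} (hα : α ∈ A) (h : Ty2 f A α)
    {p : ℝ × ℝ} (hp : p ∈ circS) (hp1 : p.1 ≠ 0) :
    ∀ O1 ∈ 𝓝 (rf p), ∀ O2 ∈ 𝓝 (cj (rf p)), ∀ᶠ z in 𝓝[outS] p,
      (fun z : ℝ × ℝ => f (ext α z)) z ∈ (fun z : ℝ × ℝ => f (ext α z)) '' (O1 ∩ outS) ∪
        (fun z : ℝ × ℝ => f (ext α z)) '' (O2 ∩ outS) := by
  intro O1 hO1 O2 hO2
  have ha := R.data.alpha α hα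
  have hE := R.data.extOk α hα
  obtain ⟨U, hU, hpU, hinj⟩ := inj_nhd (nc2 hf hS R hα hp hp1)
  have h1 : ∀ᶠ y in 𝓝 (α (rf p)), ∀ r ∈ circS, α r = y → α (rf r) ∈ U := by
    apply arc_near (u := fun r => α (rf r))
      (ha.1.comp rf_cont.continuousOn (fun r hr => rf_mem hr)) ha.1 hU
    intro r hr hrp
    have := (alpha_eq ha (rf_mem hr) hp).2 (rf_cases ((alpha_eq ha hr (rf_mem hp)).1 hrp))
    simp only [this]
    exact hpU
  have h2 := E_near ha hE (rf_mem hp) (O := interior O1 ∪ interior O2)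
    (isOpen_interior.union isOpen_interior)
    (Or.inl (mem_interior_iff_mem_nhds.2 hO1)) (Or.inr (mem_interior_iff_mem_nhds.2 hO2))
  have h3 := E_tendsto hE hp
  have h4 : Tendsto (fun z : ℝ × ℝ => f (ext α z)) (𝓝[outS] p) (𝓝 (f (α (rf p)))) := by
    rw [← h.1 p hp]; exact (hf.1.tendsto _).comp h3
  have h5 := hf.le_map (α (rf p)) (image_mem_map (h1.and h2))
  filter_upwards [h4 h5, h3 (hU.mem_nhds hpU), self_mem_nhdsWithin]
    with z k1 k3 k4
  obtain ⟨x', ⟨k1, k2⟩, hx'⟩ := k1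
  have : x' ∉ pathIm α := by
    rintro ⟨r, hr, hrz⟩
    have := hinj (k1 r hr hrz) k3 (by rw [← h.1 r hr, hrz, hx'])
    exact E_notin hE k4 ⟨rf r, rf_mem hr, this⟩
  obtain ⟨w, ⟨hw, hw2⟩, hwz⟩ := k2 this
  rcases hw with hw | hw
  · exact Or.inl ⟨w, ⟨interior_subset hw, hw2⟩, by simp only [hwz]; exact hx'⟩
  · exact Or.inr ⟨w, ⟨interior_subset hw, hw2⟩, by simp only [hwz]; exact hx'⟩

lemma f_open (hf : IsRamifiedCovering f) {O : Set Sph} (hO : IsOpen O) : IsOpen (f '' O) := by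
  rw [isOpen_iff_mem_nhds]
  rintro _ ⟨x, hx, rfl⟩
  exact hf.le_map x (image_mem_map (hO.mem_nhds hx))

lemma not2 (hf : IsRamifiedCovering f) (hS : StronglyFStable f A) (R : Reg A ext B b Φ)
    {α : ℝ × ℝ → Sph} (hα : α ∈ A) (h : Ty2 f A α)
    {p : ℝ × ℝ} (hp : p ∈ circS) (hp1 : p.1 ≠ 0) (hp2 : p.2 ≠ 0) :
    ¬ ((p, rf p) ∈ C2 f ext α ∧ (p, cj (rf p)) ∈ C2 f ext α) := by
  have ha := R.data.alpha α hα
  have hE := R.data.extOk α hα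
  apply csg_not hp (hf.1.comp_continuousOn (E_contOut hE)) ?_ (near2 hf hS R hα h hp hp1)
  · obtain ⟨U, hU, hpU, hinj⟩ := inj_nhd (nc2 hf hS R hα (rf_mem hp) (by simpa [rf] using hp1))
    obtain ⟨O1, O2, hO1, hO2, m1, m2, hd⟩ := t2_separation (cj_ne (p := rf p) (by simpa [rf] using hp2))
    obtain ⟨Q1, hQ1, q1, s1⟩ := mem_nhdsWithin.1 (E_tendsto hE (rf_mem hp) (hU.mem_nhds hpU))
    have hpU' : α (cj (rf p)) ∈ U := by rw [alpha_cj ha (rf_mem hp)]; exact hpU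
    obtain ⟨Q2, hQ2, q2, s2⟩ := mem_nhdsWithin.1 (E_tendsto hE (cj_mem (rf_mem hp)) (hU.mem_nhds hpU'))
    refine ⟨O1 ∩ Q1, (hO1.inter hQ1).mem_nhds ⟨m1, q1⟩, O2 ∩ Q2, (hO2.inter hQ2).mem_nhds ⟨m2, q2⟩, ?_⟩
    rw [Set.disjoint_left]
    rintro _ ⟨z, ⟨⟨hz, hzQ⟩, hz'⟩, rfl⟩ ⟨w, ⟨⟨hw, hwQ⟩, hw'⟩, hwz⟩
    have := E_inj hE hw' hz' (hinj (s2 ⟨hwQ, hw'⟩) (s1 ⟨hzQ, hz'⟩) hwz)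
    rw [this] at hw
    exact Set.disjoint_left.1 hd hz hw
  · intro O hs hO
    have := f_open hf (E_open ha hE hO hs)
    rwa [image_image] at this

lemma csg_symm {h : ℝ × ℝ → Sph} {p q : ℝ × ℝ} (H : (p, q) ∈ Csg h h) : (q, p) ∈ Csg h h := by
  have : Prod.swap (p, q) ∈ closure {q : (ℝ × ℝ) × (ℝ × ℝ) | q.1 ∈ outS ∧ q.2 ∈ outS ∧ h q.1 = h q.2} := by
    refine map_mem_closure continuous_swap H ?_
    rintro ⟨a, c⟩ ⟨h1, h2, h3⟩
    exact ⟨h2, h1, h3.symm⟩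
  exact this

lemma good_aux (hf : IsRamifiedCovering f) (hS : StronglyFStable f A) (R : Reg A ext B b Φ)
    {α : ℝ × ℝ → Sph} (hα : α ∈ A) (h : Ty2 f A α) {σ : ℝ} (hσ : σ ^ 2 = 1)
    (H : ∀ θ ∈ Ioo (0 : ℝ) (Real.pi / 2), (arcq σ θ, arcq σ (-θ)) ∈ C2 f ext α) : False := by
  have ha := R.data.alpha α hα
  have hE := R.data.extOk α hα
  have h01 : ((0, 1) : ℝ × ℝ) ∈ circS := by simp [circS]
  have h0σ : ((0, σ) : ℝ × ℝ) ∈ circS := by rw [← arcq_zero]; exact arcq_mem hσ 0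
  have hvert : ∀ r ∈ circS, r.1 = 0 → α r = α (0, 1) := by
    intro r hr hr0
    rw [ha.2 r hr _ h01]
    refine ⟨hr0, ?_⟩
    have : r.1 ^ 2 + r.2 ^ 2 = 1 := hr
    rw [hr0] at this
    have h3 : r.2 ^ 2 = 1 := by linarith
    exact sq_eq_sq_iff_eq_or_eq_neg.1 (by rw [h3]; norm_num)
  obtain ⟨e1, e2, a1, a2, a3, b1, b2, b3, hh⟩ := ram_form (c2 hf hS R hα h).2
  have hsq : ∀ x ∈ e1.source, ∀ y ∈ e1.source, f x = f y → e1 x ^ 2 = e1 y ^ 2 := by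
    intro x hx y hy hxy
    rw [← (hh x hx).2, ← (hh y hy).2, hxy]
  have hneg : ∀ r ∈ circS, α r ∈ e1.source → α (rf r) ∈ e1.source → e1 (α (rf r)) = - e1 (α r) := by
    intro r hr h1 h2
    rcases sq_eq_sq_iff_eq_or_eq_neg.1 (hsq _ h2 _ h1 (h.1 r hr).symm) with k | k
    · have h3 := e1.injOn h2 h1 k
      have h4 := ((ha.2 _ (rf_mem hr) _ hr).1 h3).1
      have h5 : r.1 = 0 := by simp only [rf] at h4; linarith
      have h6 := hvert r hr h5
      rw [k, h6, a2, neg_zero]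
    · exact k
  have hct := arcq_tendsto ha.1 hσ
  have hx0 : α (arcq σ 0) = α (0, 1) := by rw [arcq_zero]; exact hvert _ h0σ rfl
  -- choose the size
  have hs1 : ∀ᶠ t in 𝓝 (0 : ℝ), α (arcq σ t) ∈ e1.source := by
    apply hct.continuousAt
    show e1.source ∈ 𝓝 (α (arcq σ 0))
    rw [hx0]; exact e1.open_source.mem_nhds a1
  obtain ⟨ε, hε, hb⟩ := Metric.eventually_nhds_iff_ball.1 hs1
  obtain ⟨τ, hτ0, hτε, hτ1⟩ : ∃ τ : ℝ, 0 < τ ∧ τ < ε ∧ τ < 1 :=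
    ⟨min (ε / 2) (1 / 2), by positivity, lt_of_le_of_lt (min_le_left _ _) (by linarith),
      lt_of_le_of_lt (min_le_right _ _) (by norm_num)⟩
  have hsrc : ∀ t, |t| ≤ τ → α (arcq σ t) ∈ e1.source := by
    intro t ht
    apply hb
    rw [Metric.mem_ball, dist_zero_right, Real.norm_eq_abs]; linarith
  have hsinτ : 0 < Real.sin τ := Real.sin_pos_of_pos_of_lt_pi hτ0 (by linarith [Real.pi_gt_three])
  have hτs := hsrc τ (by rw [abs_of_pos hτ0])
  have hρ : 0 < ‖e1 (α (arcq σ τ))‖ := by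
    rw [norm_pos_iff]
    intro h0
    have h1 := e1.injOn hτs a1 (by rw [h0, a2])
    have h2 := ((ha.2 _ (arcq_mem hσ τ) _ h01).1 h1).1
    simp only [arcq] at h2
    exact hsinτ.ne' h2
  set ρ := ‖e1 (α (arcq σ τ))‖ with hρd
  have hV : e1.source ∩ e1 ⁻¹' Metric.ball 0 ρ ∈ 𝓝 (α (0, σ)) := by
    rw [← arcq_zero, hx0]
    refine inter_mem (e1.open_source.mem_nhds a1) (e1.continuousAt a1 ?_)
    rw [a2]; exact Metric.ball_mem_nhds _ hρ
  obtain ⟨O', hO', hq', s'⟩ := mem_nhdsWithin.1 (E_tendsto hE h0σ hV)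
  obtain ⟨N, hN, hNc, hNo, hNn⟩ := halfbox h0σ (hO'.mem_nhds hq')
  obtain ⟨O'', hO'', hq'', s''⟩ := mem_nhdsWithin.1 hNn
  have hNV : ∀ z ∈ N, ext α z ∈ e1.source ∧ ‖e1 (ext α z)‖ < ρ := by
    intro z hz
    have := s' (hN hz)
    exact ⟨this.1, by simpa using this.2⟩
  have t1 : ∀ᶠ t in 𝓝 (0 : ℝ), arcq σ t ∈ O'' := by
    apply (arcq_cont σ).continuousAt
    rw [arcq_zero]; exact hO''.mem_nhds hq''
  have t2 : ∀ᶠ t in 𝓝 (0 : ℝ), arcq σ (-t) ∈ O'' := by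
    apply ((arcq_cont σ).comp continuous_neg).continuousAt
    simp only [Function.comp, neg_zero]
    rw [arcq_zero]; exact hO''.mem_nhds hq''
  have e : ∀ᶠ t in 𝓝[>] (0 : ℝ), t ∈ Ioo 0 (Real.pi / 2) := Ioo_mem_nhdsGT (by positivity)
  have e' : ∀ᶠ t in 𝓝[>] (0 : ℝ), arcq σ t ∈ O'' ∧ arcq σ (-t) ∈ O'' :=
    (t1.and t2).filter_mono nhdsWithin_le_nhds
  obtain ⟨θ, hθO, hθ⟩ := (e'.and e).exists
  have hsinθ : 0 < Real.sin θ := Real.sin_pos_of_pos_of_lt_pi hθ.1 (by linarith [hθ.2, Real.pi_pos])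
  have hR : IsOpen {z : ℝ × ℝ | 0 < z.1} := isOpen_lt continuous_const continuous_fst
  have hL : IsOpen {z : ℝ × ℝ | z.1 < 0} := isOpen_lt continuous_fst continuous_const
  obtain ⟨⟨ζ, ζ'⟩, hzz, k1, k2, k3⟩ := mem_closure_iff.1 (H θ hθ)
    ((O'' ∩ {z : ℝ × ℝ | 0 < z.1}) ×ˢ (O'' ∩ {z : ℝ × ℝ | z.1 < 0}))
    ((hO''.inter hR).prod (hO''.inter hL))
    ⟨⟨hθO.1, hsinθ⟩, ⟨hθO.2, by simp [arcq, hsinθ]⟩⟩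
  obtain ⟨⟨z1, z2⟩, ⟨z3, z4⟩⟩ := hzz
  simp only [mem_ofPred_eq] at z1 z2 z3 z4 k1 k2 k3
  have hζN : ζ ∈ N := s'' ⟨z1, k1⟩
  have hζN' : ζ' ∈ N := s'' ⟨z3, k2⟩
  have hopp : e1 (ext α ζ') = - e1 (ext α ζ) := by
    rcases sq_eq_sq_iff_eq_or_eq_neg.1 (hsq _ (hNV ζ' hζN').1 _ (hNV ζ hζN).1 k3.symm) with k | k
    · have h3 := e1.injOn (hNV ζ' hζN').1 (hNV ζ hζN).1 k
      have h4 := E_inj hE k2 k1 h3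
      rw [h4] at z4; linarith
    · exact k
  have hJ := hNc.joinedIn ζ hζN ζ' hζN'
  have hmem : ∀ s, hJ.somePath s ∈ N := hJ.somePath_mem
  refine winding_I (m := fun s => e1 (ext α (hJ.somePath s)))
    (γ := fun t => e1 (α (arcq σ (τ * t))) ^ 2) (ρ := ρ) ?_ ?_ ?_ ?_ ?_ ?_ ?_
  · refine e1.continuousOn.comp_continuous ?_ (fun s => (hNV _ (hmem s)).1)
    exact (E_contOut hE).comp_continuous hJ.somePath.continuous (fun s => (hN (hmem s)).2)
  · refine Continuous.pow (e1.continuousOn.comp_continuous ?_ fun t => hsrc _ ?_) 2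
    · exact hct.comp (by fun_prop)
    · rw [abs_of_nonneg (mul_nonneg hτ0.le t.2.1)]
      exact mul_le_of_le_one_right hτ0.le t.2.2
  · exact fun s => (hNV _ (hmem s)).2
  · simp [hx0, a2]
  · simp [hρd]
  · intro s t hst
    have hzN := hmem s
    have ht : |τ * (t : ℝ)| ≤ τ := by
      rw [abs_of_nonneg (mul_nonneg hτ0.le t.2.1)]
      exact mul_le_of_le_one_right hτ0.le t.2.2
    have hr := arcq_mem hσ (τ * t)
    have g1 := hsrc _ ht
    have g2 := hsrc (-(τ * t)) (by rwa [abs_neg])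
    rw [← arcq_rf] at g2
    have hno := E_notin hE (hN hzN).2
    rcases sq_eq_sq_iff_eq_or_eq_neg.1 hst with k | k
    · exact hno ⟨_, hr, (e1.injOn (hNV _ hzN).1 g1 k).symm⟩
    · rw [← hneg _ hr g1 g2] at k
      exact hno ⟨_, rf_mem hr, (e1.injOn (hNV _ hzN).1 g2 k).symm⟩
  · simp [hopp]

lemma good (hf : IsRamifiedCovering f) (hS : StronglyFStable f A) (R : Reg A ext B b Φ)
    {α : ℝ × ℝ → Sph} (hα : α ∈ A) (h : Ty2 f A α)
    {p : ℝ × ℝ} (hp : p ∈ circS) (hp1 : p.1 ≠ 0) (hp2 : p.2 ≠ 0) : (p, rf p) ∉ C2 f ext α := by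
  intro hc
  wlog hpos : 0 < p.1 generalizing p
  · refine this (rf_mem hp) (by simpa [rf] using hp1) (by simpa [rf] using hp2) ?_ ?_
    · rw [rf_rf]; exact csg_symm hc
    · simp only [rf]
      rcases lt_or_gt_of_ne hp1 with h | h
      · linarith
      · exact absurd h hpos
  obtain ⟨σ, θ, hσ, hθ, hpe, hθ0⟩ := exists_arcq hp hp2
  have hθ1 := hθ0 hpos
  have hsub : ∀ t ∈ Ioo (0 : ℝ) (Real.pi / 2), (arcq σ t).1 ≠ 0 ∧ (arcq σ t).2 ≠ 0 := fun t ht =>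
    ⟨(Real.sin_pos_of_pos_of_lt_pi ht.1 (by linarith [ht.2, Real.pi_pos])).ne',
      arcq_two_ne hσ ⟨by linarith [ht.1, Real.pi_pos], ht.2⟩⟩
  have hnot : ∀ t ∈ Ioo (0 : ℝ) (Real.pi / 2), ¬ ((arcq σ t, rf (arcq σ t)) ∈ C2 f ext α ∧
      (arcq σ t, cj (rf (arcq σ t))) ∈ C2 f ext α) := fun t ht =>
    not2 hf hS R hα h (arcq_mem hσ t) (hsub t ht).1 (hsub t ht).2
  have hconst := csg_const (D := C2 f ext α) isClosed_closure (P := arcq σ)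
    (Q1 := fun t => rf (arcq σ t)) (Q2 := fun t => cj (rf (arcq σ t))) (arcq_cont σ)
    (rf_cont.comp (arcq_cont σ)) (cj_cont.comp (rf_cont.comp (arcq_cont σ)))
    (J := Ioo (0 : ℝ) (Real.pi / 2)) isPreconnected_Ioo
    (fun t ht => csg_or (arcq_mem hσ t) (near2 hf hS R hα h (arcq_mem hσ t) (hsub t ht).1)) hnot
  rcases hconst with hc' | hc'
  · refine good_aux hf hS R hα h hσ fun t ht => ?_
    rw [← arcq_rf]; exact hc' t ht
  · rw [hpe] at hc
    exact hnot θ ⟨hθ1, hθ.2⟩ ⟨hc, hc' θ ⟨hθ1, hθ.2⟩⟩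

end


section
variable {A : Set (ℝ × ℝ → Sph)} {ext : (ℝ × ℝ → Sph) → OP → Sph}
    {B : Set (ℝ × ℝ → Sph)} {b : (ℝ × ℝ → Sph) → ℝ × ℝ → Sph} {Φ : Sph → Sph} {f : Sph → Sph}

def Lam (A : Set (ℝ × ℝ → Sph)) (Φ f : Sph → Sph) : Set (Sph × Sph) :=
  closure {q | ∃ x, x ∉ famIm A ∧ q = (Φ x, Φ (f x))}

lemma fS (hS : StronglyFStable f A) {x : Sph} (hx : x ∉ famIm A) : f x ∉ famIm A :=
  fun h => hx (hS.1.2 h)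

lemma ty (hS : StronglyFStable f A) {α : ℝ × ℝ → Sph} (hα : α ∈ A) :
    (∃ α' ∈ A, ∀ p ∈ circS, f (α p) = α' p) ∨ Ty2 f A α := hS.1.1 α hα

lemma ty2_notin {α : ℝ × ℝ → Sph} (h : Ty2 f A α) {p : ℝ × ℝ} (hp : p ∈ circS) :
    f (α p) ∉ famIm A := fun h' => Set.disjoint_left.1 h.2 ⟨_, ⟨p, hp, rfl⟩, rfl⟩ h'

lemma lam_ultra {y w : Sph} (h : (y, w) ∈ Lam A Φ f) :
    ∃ (u : Ultrafilter (Sph × Sph)) (v : Sph × Sph → Sph) (x : Sph), Tendsto v u (𝓝 x) ∧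
      (∀ᶠ i in u, v i ∉ famIm A) ∧ Tendsto (fun i => Φ (v i)) u (𝓝 y) ∧
      Tendsto (fun i => Φ (f (v i))) u (𝓝 w) := by
  obtain ⟨u, hu, hux⟩ := mem_closure_iff_ultrafilter.1 h
  have hch : ∀ q : Sph × Sph, ∃ x, (∃ x, x ∉ famIm A ∧ q = (Φ x, Φ (f x))) →
      x ∉ famIm A ∧ q = (Φ x, Φ (f x)) := by
    intro q
    by_cases hq : ∃ x, x ∉ famIm A ∧ q = (Φ x, Φ (f x))
    · exact ⟨hq.choose, fun _ => hq.choose_spec⟩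
    · exact ⟨q.1, fun h => absurd h hq⟩
  choose v hv using hch
  obtain ⟨x, hx⟩ := ultra_lim u v
  have hu' : ∀ᶠ q in (u : Filter (Sph × Sph)), v q ∉ famIm A ∧ q = (Φ (v q), Φ (f (v q))) :=
    Filter.mem_of_superset hu fun q hq => hv q hq
  have h1 : Tendsto (fun q : Sph × Sph => q.1) u (𝓝 y) := (continuous_fst.tendsto (y, w)).mono_left hux
  have h2 : Tendsto (fun q : Sph × Sph => q.2) u (𝓝 w) := (continuous_snd.tendsto (y, w)).mono_left hux
  refine ⟨u, v, x, hx, hu'.mono fun q hq => hq.1, ?_, ?_⟩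
  · refine h1.congr' (hu'.mono fun q hq => ?_)
    exact congrArg Prod.fst hq.2
  · refine h2.congr' (hu'.mono fun q hq => ?_)
    exact congrArg Prod.snd hq.2

lemma lam_gam (hf : IsRamifiedCovering f) (hS : StronglyFStable f A) (R : Reg A ext B b Φ) {y w : Sph}
    (h : (y, w) ∈ Lam A Φ f) : ∃ x, (x, y) ∈ Gam A Φ ∧ (f x, w) ∈ Gam A Φ := by
  obtain ⟨u, v, x, h1, h2, h3, h4⟩ := lam_ultra h
  exact ⟨x, R.gam_lim h1 h3 (h2.mono fun i hi => R.gam_graph hi),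
    R.gam_lim ((hf.1.tendsto x).comp h1) h4 (h2.mono fun i hi => R.gam_graph (fS hS hi))⟩

lemma lam_t1 (hf : IsRamifiedCovering f) (hS : StronglyFStable f A) (R : Reg A ext B b Φ)
    {α α' : ℝ × ℝ → Sph} (hα : α ∈ A) (hα' : α' ∈ A) (h : ∀ p ∈ circS, f (α p) = α' p)
    {p : ℝ × ℝ} (hp : p ∈ circS) {w : Sph} (hw : (b α p, w) ∈ Lam A Φ f) :
    (w = b α' p ∧ ((p, p) ∈ C1 f ext α α' ∨ (rf p, rf p) ∈ C1 f ext α α')) ∨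
    (w = b α' (cj p) ∧ ((p, cj p) ∈ C1 f ext α α' ∨ (rf p, cj (rf p)) ∈ C1 f ext α α')) := by
  have ha := R.data.alpha α hα
  have ha' := R.data.alpha α' hα'
  have hE := R.data.extOk α hα
  have hE' := R.data.extOk α' hα'
  obtain ⟨u, v, x, h1, h2, h3, h4⟩ := lam_ultra hw
  have hx := R.gam4 hα hp (R.gam_lim h1 h3 (h2.mono fun i hi => R.gam_graph hi))
  obtain ⟨p0, hp0, hx⟩ : ∃ p0 ∈ circS, x = α p0 := by
    rcases hx with hx | hx
    · exact ⟨p, hp, hx⟩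
    · exact ⟨rf p, rf_mem hp, hx⟩
  obtain ⟨ζ, hζ, hor⟩ := lift_out ha hE u hp0 (hx ▸ h1) (h2.mono fun i hi => notin_path hα hi)
  obtain ⟨q, hq, hζq⟩ : ∃ q ∈ circS, Tendsto ζ u (𝓝[outS] q) := by
    rcases hor with k | k
    · exact ⟨p0, hp0, k⟩
    · exact ⟨_, cj_mem hp0, k⟩
  have h5 : ∀ᶠ i in (u : Filter _), (ext α (ζ i), Φ (v i)) ∈ Gam A Φ := by
    filter_upwards [hζ, h2] with i k1 k2
    rw [k1.2]; exact R.gam_graph k2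
  have hbq := tendsto_nhds_unique (R.gam_key hα hq hζq h5) h3
  have hq2 := (R.b_eq hα hα hq hp hbq).2
  have h6 : Tendsto (fun i => f (v i)) u (𝓝 (α' q)) := by
    rw [← h q hq]
    refine ((hf.1.tendsto _).comp ((E_tendsto hE hq).comp hζq)).congr' ?_
    filter_upwards [hζ] with i k1
    simp only [Function.comp]; rw [k1.2]
  obtain ⟨ξ, hξ, hor'⟩ := lift_out ha' hE' u hq h6 (h2.mono fun i hi => notin_path hα' (fS hS hi))
  have h7 : ∀ᶠ i in (u : Filter _), (ext α' (ξ i), Φ (f (v i))) ∈ Gam A Φ := by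
    filter_upwards [hξ, h2] with i k1 k2
    rw [k1.2]; exact R.gam_graph (fS hS k2)
  have hC : ∀ q', Tendsto ξ u (𝓝[outS] q') → (q, q') ∈ C1 f ext α α' := by
    intro q' hq'
    refine mem_closure_of_tendsto ((hζq.mono_right nhdsWithin_le_nhds).prodMk_nhds
      (hq'.mono_right nhdsWithin_le_nhds)) ?_
    filter_upwards [hξ, hζ] with i k1 k2
    exact ⟨k2.1, k1.1, by rw [k1.2, k2.2]⟩
  rcases hor' with k | k
  · left
    have e := tendsto_nhds_unique h4 (R.gam_key hα' hq k h7)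
    have c := hC _ k
    rcases hq2 with rfl | rfl
    · exact ⟨e, Or.inl c⟩
    · exact ⟨by rw [e, R.b_rf hα' hp], Or.inr c⟩
  · right
    have e := tendsto_nhds_unique h4 (R.gam_key hα' (cj_mem hq) k h7)
    have c := hC _ k
    rcases hq2 with rfl | rfl
    · exact ⟨e, Or.inl c⟩
    · exact ⟨by rw [e, cj_rf, R.b_rf hα' (cj_mem hp)], Or.inr c⟩

lemma lam_phi (hf : IsRamifiedCovering f) (hS : StronglyFStable f A) (R : Reg A ext B b Φ) {x0 w : Sph}
    (hx0 : x0 ∉ famIm A) (h : (Φ x0, w) ∈ Lam A Φ f) : w = Φ (f x0) := by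
  obtain ⟨x, h1, h2⟩ := lam_gam hf hS R h
  rw [R.gam3 hx0 h1] at h2
  exact R.gam1 h2 (fS hS hx0)

lemma lam_t2 (hf : IsRamifiedCovering f) (hS : StronglyFStable f A) (R : Reg A ext B b Φ)
    {α : ℝ × ℝ → Sph} (hα : α ∈ A) (hT : Ty2 f A α) {p : ℝ × ℝ} (hp : p ∈ circS) {w : Sph}
    (h : (b α p, w) ∈ Lam A Φ f) : w = Φ (f (α p)) := by
  obtain ⟨x, h1, h2⟩ := lam_gam hf hS R h
  have : f x = f (α p) := by
    rcases R.gam4 hα hp h1 with rfl | rfl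
    · rfl
    · exact (hT.1 p hp).symm
  rw [this] at h2
  exact R.gam1 h2 (ty2_notin hT hp)

lemma cj_eq_self {p : ℝ × ℝ} (h : p.2 = 0) : cj p = p := by
  ext <;> simp [cj, h]

lemma lam_uniq (hf : IsRamifiedCovering f) (hS : StronglyFStable f A) (R : Reg A ext B b Φ) {y w w' : Sph}
    (h : (y, w) ∈ Lam A Φ f) (h' : (y, w') ∈ Lam A Φ f) : w = w' := by
  rcases R.y_cases y with ⟨x0, hx0, rfl⟩ | ⟨α, hα, p, hp, rfl⟩
  · rw [lam_phi hf hS R hx0 h, lam_phi hf hS R hx0 h']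
  · rcases ty hS hα with ⟨α', hα', hT⟩ | hT
    · have k := lam_t1 hf hS R hα hα' hT hp h
      have k' := lam_t1 hf hS R hα hα' hT hp h'
      by_cases hp2 : p.2 = 0
      · rw [cj_eq_self hp2] at k k'
        have e : w = b α' p := by tauto
        have e' : w' = b α' p := by tauto
        rw [e, e']
      · rcases k with ⟨k1, k2⟩ | ⟨k1, k2⟩ <;> rcases k' with ⟨k1', k2'⟩ | ⟨k1', k2'⟩
        · rw [k1, k1']
        · exact (sgn1 hf hS R hα hα' hT hp hp2 k2 k2').elim
        · exact (sgn1 hf hS R hα hα' hT hp hp2 k2' k2).elim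
        · rw [k1, k1']
    · rw [lam_t2 hf hS R hα hT hp h, lam_t2 hf hS R hα hT hp h']

structure GD (A : Set (ℝ × ℝ → Sph)) (ext : (ℝ × ℝ → Sph) → OP → Sph)
    (B : Set (ℝ × ℝ → Sph)) (b : (ℝ × ℝ → Sph) → ℝ × ℝ → Sph) (Φ f g : Sph → Sph) : Prop where
  R : Reg A ext B b Φ
  hf : IsRamifiedCovering f
  hS : StronglyFStable f A
  cont : Continuous g
  gphi : ∀ x, x ∉ famIm A → g (Φ x) = Φ (f x)
  gam : ∀ x y, (x, y) ∈ Gam A Φ → (f x, g y) ∈ Gam A Φ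
  gt2 : ∀ α ∈ A, Ty2 f A α → ∀ p ∈ circS, g (b α p) = Φ (f (α p))

lemma exists_GD (hf : IsRamifiedCovering f) (hS : StronglyFStable f A) (R : Reg A ext B b Φ) :
    ∃ g, GD A ext B b Φ f g := by
  have hex : ∀ y, ∃ w, (y, w) ∈ Lam A Φ f := by
    intro y
    obtain ⟨x, hx⟩ := R.gam_snd y
    obtain ⟨u, h1, h2, h3⟩ := R.gam_ultra hx
    obtain ⟨w, hw⟩ := ultra_lim u (fun v => Φ (f v))
    exact ⟨w, mem_closure_of_tendsto (h3.prodMk_nhds hw) (h2.mono fun v hv => ⟨v, hv, rfl⟩)⟩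
  choose g hg using hex
  have hgu : ∀ y w, (y, w) ∈ Lam A Φ f → w = g y := fun y w h => lam_uniq hf hS R h (hg y)
  refine ⟨g, R, hf, hS, ?_, ?_, ?_, ?_⟩
  · rw [continuous_iff_continuousAt]
    intro y
    rw [ContinuousAt, tendsto_iff_ultrafilter]
    intro u hu
    obtain ⟨w, hw⟩ := ultra_lim u g
    have hid : Tendsto id (u : Filter Sph) (𝓝 y) := hu
    have : (y, w) ∈ Lam A Φ f :=
      isClosed_closure.mem_of_tendsto (hid.prodMk_nhds hw) (Eventually.of_forall fun z => hg z)
    rw [← hgu _ _ this]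
    exact hw
  · intro x hx
    exact lam_phi hf hS R hx (hg _)
  · intro x y hxy
    obtain ⟨u, h1, h2, h3⟩ := R.gam_ultra hxy
    obtain ⟨w, hw⟩ := ultra_lim u (fun v => Φ (f v))
    have : (y, w) ∈ Lam A Φ f :=
      mem_closure_of_tendsto (h3.prodMk_nhds hw) (h2.mono fun v hv => ⟨v, hv, rfl⟩)
    rw [← hgu _ _ this]
    exact R.gam_lim ((hf.1.tendsto x).comp h1) hw (h2.mono fun i hi => R.gam_graph (fS hS hi))
  · intro α hα hT p hp
    exact lam_t2 hf hS R hα hT hp (hg _)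

end


lemma neg_ne {p : ℝ × ℝ} (hp : p ∈ circS) : p ≠ rf (cj p) := by
  intro h
  have h1 := congrArg Prod.fst h
  have h2 := congrArg Prod.snd h
  simp only [rf, cj] at h1 h2
  have h3 : p.1 = 0 := by linarith
  have h4 : p.2 = 0 := by linarith
  have h5 : p.1 ^ 2 + p.2 ^ 2 = 1 := hp
  rw [h3, h4] at h5
  norm_num at h5

lemma cj_self {p : ℝ × ℝ} (h : p = cj p) : p.2 = 0 := by
  by_contra h'
  exact cj_ne h' h

namespace GD
variable {A : Set (ℝ × ℝ → Sph)} {ext : (ℝ × ℝ → Sph) → OP → Sph}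
    {B : Set (ℝ × ℝ → Sph)} {b : (ℝ × ℝ → Sph) → ℝ × ℝ → Sph} {Φ : Sph → Sph} {f g : Sph → Sph}
    (G : GD A ext B b Φ f g)
include G

lemma g_of {v a y : Sph} (hv : v ∉ famIm A) (ha : f a = v) (h : (a, y) ∈ Gam A Φ) : g y = Φ v := by
  have := G.gam a y h
  rw [ha] at this
  exact G.R.gam1 this hv

lemma t1_hit {α α' : ℝ × ℝ → Sph} (hα : α ∈ A) (hα' : α' ∈ A) (h : ∀ p ∈ circS, f (α p) = α' p)
    {p : ℝ × ℝ} (hp : p ∈ circS) : b α' p = g (b α p) ∨ b α' p = g (b α (cj p)) := by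
  obtain ⟨u, h1, h2, h3⟩ := G.R.gam_ultra (G.R.gam_ab hα' hp)
  obtain ⟨s, hs, hs2⟩ := G.hf.exists_section (α p)
  rw [h p hp] at hs hs2
  choose c hc using G.R.gam_fst
  obtain ⟨y, hy⟩ := ultra_lim u (fun v => c (s v))
  have hy1 : (α p, y) ∈ Gam A Φ := G.R.gam_lim (hs.comp h1) hy (Eventually.of_forall fun v => hc _)
  have h4 : ∀ᶠ v in (u : Filter Sph), g (c (s v)) = Φ v := by
    filter_upwards [h2, h1.eventually hs2] with v k1 k2
    exact G.g_of k1 k2 (hc _)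
  have h5 : g y = b α' p :=
    tendsto_nhds_unique ((G.cont.tendsto y).comp hy) (h3.congr' (h4.mono fun v hv => hv.symm))
  rcases G.R.gam2 hα hp hy1 with rfl | rfl
  · left; exact h5.symm
  · right; exact h5.symm

lemma t1_inj {α α' : ℝ × ℝ → Sph} (hα : α ∈ A) (hα' : α' ∈ A) (h : ∀ p ∈ circS, f (α p) = α' p)
    {p : ℝ × ℝ} (hp : p ∈ circS) (he : g (b α p) = g (b α (cj p))) : b α p = b α (cj p) := by
  have h1 := G.t1_hit hα hα' h hp
  have h2 := G.t1_hit hα hα' h (cj_mem hp)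
  rw [cj_cj] at h2
  have h3 : b α' p = b α' (cj p) := by
    rw [he, or_self] at h1 h2
    rw [h1, h2]
  rcases (G.R.b_eq hα' hα' hp (cj_mem hp) h3).2 with k | k
  · rw [← k]
  · exact absurd k (neg_ne hp)

lemma fib_finite (w : Sph) : (g ⁻¹' {w}).Finite := by
  have f1 : ∀ w, {c | (c, w) ∈ Gam A Φ}.Finite := by
    intro w
    rcases G.R.y_cases w with ⟨x0, hx0, rfl⟩ | ⟨α, hα, p, hp, rfl⟩
    · exact (finite_singleton x0).subset fun c hc => G.R.gam3 hx0 hc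
    · exact (toFinite {α p, α (rf p)}).subset fun c hc => G.R.gam4 hα hp hc
  have f2 : ∀ x, {y | (x, y) ∈ Gam A Φ}.Finite := by
    intro x
    by_cases hx : x ∈ famIm A
    · obtain ⟨α, hα, p, hp, rfl⟩ := fam_cases hx
      exact (toFinite {b α p, b α (cj p)}).subset fun c hc => G.R.gam2 hα hp hc
    · exact (finite_singleton (Φ x)).subset fun c hc => G.R.gam1 hc hx
  have f3 : (⋃ c ∈ {c | (c, w) ∈ Gam A Φ}, ⋃ x ∈ f ⁻¹' {c}, {y | (x, y) ∈ Gam A Φ}).Finite :=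
    (f1 w).biUnion fun c _ => (G.hf.fib_finite c).biUnion fun x _ => f2 x
  refine f3.subset ?_
  rintro y rfl
  obtain ⟨x, hx⟩ := G.R.gam_snd y
  exact mem_biUnion (show f x ∈ _ from G.gam x y hx) (mem_biUnion (show x ∈ f ⁻¹' {f x} from rfl) hx)

lemma open_of {y : Sph} (H : ∀ u : Ultrafilter Sph, (∀ᶠ v in u, v ∉ famIm A) →
    Tendsto Φ u (𝓝 (g y)) → ∃ β : Sph → Sph, (∀ᶠ v in u, g (β v) = Φ v) ∧ Tendsto β u (𝓝 y)) :
    𝓝 (g y) ≤ map g (𝓝 y) := by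
  intro S hS
  obtain ⟨K, hK, hKc, hKS⟩ := exists_mem_nhds_isClosed_subset (Filter.mem_map.1 hS)
  refine mem_of_superset ?_ (image_subset_iff.2 hKS)
  by_contra hcon
  have hcl : IsClosed (g '' K) := (hKc.isCompact.image G.cont).isClosed
  have hne : (comap Φ (𝓝 (g y)) ⊓ 𝓟 {v | v ∉ famIm A ∧ Φ v ∉ g '' K}).NeBot := by
    rw [inf_principal_neBot_iff]
    rintro U ⟨V, hV, hVU⟩
    obtain ⟨V', hV'V, hV', hyV'⟩ := mem_nhds_iff.1 hV
    have : (V' ∩ (g '' K)ᶜ).Nonempty := by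
      by_contra hemp
      rw [not_nonempty_iff_eq_empty] at hemp
      refine hcon (mem_of_superset (hV'.mem_nhds hyV') fun z hz => ?_)
      by_contra hz'
      exact (hemp ▸ (⟨hz, hz'⟩ : z ∈ V' ∩ (g '' K)ᶜ) : z ∈ (∅ : Set Sph))
    obtain ⟨w, ⟨hw1, hw2⟩, hw3⟩ := G.R.denseB.inter_open_nonempty _ (hV'.inter hcl.isOpen_compl) this
    obtain ⟨v, hv, rfl⟩ := G.R.reg.bijOn.surjOn hw3
    exact ⟨v, hVU (hV'V hw1), hv, hw2⟩
  let u := Ultrafilter.of (comap Φ (𝓝 (g y)) ⊓ 𝓟 {v | v ∉ famIm A ∧ Φ v ∉ g '' K})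
  have hu : (u : Filter Sph) ≤ _ := Ultrafilter.of_le _
  have h1 : ∀ᶠ v in (u : Filter Sph), v ∉ famIm A ∧ Φ v ∉ g '' K :=
    hu (mem_inf_of_right (mem_principal_self _))
  have h2 : Tendsto Φ u (𝓝 (g y)) := tendsto_iff_comap.2 (hu.trans inf_le_left)
  obtain ⟨β, hβ, hβy⟩ := H u (h1.mono fun v hv => hv.1) h2
  obtain ⟨v, ⟨k1, k2⟩, k3⟩ := ((h1.and hβ).and (hβy hK)).exists
  exact k1.2 ⟨β v, k3, k2⟩

lemma lift_any {α : ℝ × ℝ → Sph} (hα : α ∈ A) {p : ℝ × ℝ} (hp : p ∈ circS) (u : Ultrafilter Sph)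
    {a : Sph → Sph} (ha : Tendsto a u (𝓝 (α p))) :
    (∃ β : Sph → Sph, (∀ᶠ v in u, (a v, β v) ∈ Gam A Φ) ∧ Tendsto β u (𝓝 (b α p))) ∨
    (p.2 ≠ 0 ∧ ∃ ζ : Sph → ℝ × ℝ, (∀ᶠ v in u, ζ v ∈ outS ∧ ext α (ζ v) = a v) ∧
      Tendsto ζ u (𝓝[outS] (cj p))) := by
  have hal := G.R.data.alpha α hα
  have hE := G.R.data.extOk α hα
  choose c hc using G.R.gam_fst
  rcases u.em (fun v => a v ∈ pathIm α) with hin | hout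
  · left
    have hch : ∀ v, ∃ r ∈ circS, a v ∈ pathIm α → α r = a v := by
      intro v
      by_cases hv : a v ∈ pathIm α
      · obtain ⟨r, hr, hrv⟩ := hv
        exact ⟨r, hr, fun _ => hrv⟩
      · exact ⟨p, hp, fun h => absurd h hv⟩
    choose r hr hrv using hch
    obtain ⟨q, hq, hqr⟩ := isCompact_iff_ultrafilter_le_nhds.1 circS_compact (u.map r)
      (by
        rw [Ultrafilter.coe_map, le_principal_iff]
        exact Filter.mem_map.2 (Filter.univ_mem' hr))
    have hrq : Tendsto r u (𝓝[circS] q) :=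
      tendsto_nhdsWithin_iff.2 ⟨hqr, Eventually.of_forall hr⟩
    have hαq : α q = α p := by
      refine tendsto_nhds_unique ((hal.1 q hq).tendsto.comp hrq) (ha.congr' ?_)
      filter_upwards [hin] with v hv
      exact (hrv v hv).symm
    obtain ⟨r', hr', hr'p, hr'a⟩ : ∃ r' : Sph → ℝ × ℝ, (∀ v, r' v ∈ circS) ∧
        Tendsto r' u (𝓝[circS] p) ∧ ∀ v, α (r' v) = α (r v) := by
      rcases (alpha_eq hal hq hp).1 hαq with rfl | rfl
      · exact ⟨r, hr, hrq, fun _ => rfl⟩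
      · refine ⟨fun v => cj (r v), fun v => cj_mem (hr v), ?_, fun v => alpha_cj hal (hr v)⟩
        refine tendsto_nhdsWithin_iff.2 ⟨?_, Eventually.of_forall fun v => cj_mem (hr v)⟩
        have := (cj_cont.tendsto (cj p)).comp (hrq.mono_right nhdsWithin_le_nhds)
        rwa [cj_cj] at this
    refine ⟨fun v => b α (r' v), ?_, ?_⟩
    · filter_upwards [hin] with v hv
      rw [← hrv v hv, ← hr'a v]
      exact G.R.gam_ab hα (hr' v)
    · exact ((G.R.data.beta _ (G.R.b_mem hα)).1 p hp).tendsto.comp hr'p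
  · obtain ⟨ζ, hζ, hor⟩ := lift_out hal hE u hp ha hout
    have hgk : ∀ᶠ v in (u : Filter Sph), (ext α (ζ v), c (a v)) ∈ Gam A Φ := by
      filter_upwards [hζ] with v hv
      rw [hv.2]; exact hc _
    rcases hor with k | k
    · left
      exact ⟨fun v => c (a v), Eventually.of_forall fun v => hc _, G.R.gam_key hα hp k hgk⟩
    · by_cases hp2 : p.2 = 0
      · left
        rw [cj_eq_self hp2] at k
        exact ⟨fun v => c (a v), Eventually.of_forall fun v => hc _, G.R.gam_key hα hp k hgk⟩
      · right
        exact ⟨hp2, ζ, hζ, k⟩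

lemma open_at {y : Sph} (hy : ∀ α ∈ A, Ty2 f A α → ∀ p ∈ circS, y = b α p → p.1 ≠ 0) :
    𝓝 (g y) ≤ map g (𝓝 y) := by
  apply G.open_of
  intro u hu hΦ
  choose c hc using G.R.gam_fst
  obtain ⟨v0, hv0⟩ := ultra_lim u (id : Sph → Sph)
  have hv0g : (v0, g y) ∈ Gam A Φ := G.R.gam_lim hv0 hΦ (hu.mono fun v hv => G.R.gam_graph hv)
  have sec : ∀ x, f x = v0 → ∃ a : Sph → Sph, Tendsto a u (𝓝 x) ∧ ∀ᶠ v in (u : Filter Sph), f (a v) = v := by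
    rintro x rfl
    obtain ⟨s, hs, hs2⟩ := G.hf.exists_section x
    exact ⟨s, hs.comp hv0, hv0.eventually hs2⟩
  have fin : ∀ a β : Sph → Sph, (∀ᶠ v in (u : Filter Sph), f (a v) = v) →
      (∀ᶠ v in (u : Filter Sph), (a v, β v) ∈ Gam A Φ) → ∀ᶠ v in (u : Filter Sph), g (β v) = Φ v := by
    intro a β h1 h2
    filter_upwards [h1, h2, hu] with v k1 k2 k3
    exact G.g_of k3 k1 k2
  rcases G.R.y_cases y with ⟨x0, hx0, rfl⟩ | ⟨α, hα, p, hp, rfl⟩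
  · rw [G.gphi x0 hx0] at hv0g
    have := G.R.gam3 (fS G.hS hx0) hv0g
    obtain ⟨a, ha, hfa⟩ := sec x0 this.symm
    have e : ∀ᶠ v in (u : Filter Sph), (a v, c (a v)) ∈ Gam A Φ := Eventually.of_forall fun v => hc _
    exact ⟨fun v => c (a v), fin a _ hfa e, G.R.gam_tendsto ha e fun z hz => G.R.gam1 hz hx0⟩
  · rcases ty G.hS hα with ⟨α', hα', hT⟩ | hT
    · have ha' := G.R.data.alpha α' hα'
      have h1 := G.gam _ _ (G.R.gam_ab hα hp)
      rw [hT p hp] at h1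
      have h2 : v0 = α' p ∨ v0 = α' (rf p) := by
        rcases G.R.gam2 hα' hp h1 with k | k
        · rw [k] at hv0g
          exact G.R.gam4 hα' hp hv0g
        · rw [k] at hv0g
          have := G.R.gam4 hα' (cj_mem hp) hv0g
          rwa [← cj_rf, alpha_cj ha' hp, alpha_cj ha' (rf_mem hp)] at this
      obtain ⟨q, hq, hqp, hvq⟩ : ∃ q ∈ circS, (q = p ∨ q = rf p) ∧ v0 = α' q := by
        rcases h2 with k | k
        · exact ⟨p, hp, Or.inl rfl, k⟩
        · exact ⟨rf p, rf_mem hp, Or.inr rfl, k⟩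
      obtain ⟨a, ha, hfa⟩ := sec (α q) (by rw [hT q hq, hvq])
      have e : ∀ᶠ v in (u : Filter Sph), (a v, c (a v)) ∈ Gam A Φ := Eventually.of_forall fun v => hc _
      have e2 := fin a _ hfa e
      obtain ⟨y', hy'⟩ := ultra_lim u (fun v => c (a v))
      have hg : g y' = g (b α p) :=
        tendsto_nhds_unique ((G.cont.tendsto y').comp hy') (hΦ.congr' (e2.mono fun v hv => hv.symm))
      have h3 : y' = b α p ∨ y' = b α (cj p) := by
        have h4 := G.R.gam2 hα hq (G.R.gam_lim ha hy' e)
        rcases hqp with rfl | rfl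
        · exact h4
        · rwa [cj_rf, G.R.b_rf hα hp, G.R.b_rf hα (cj_mem hp)] at h4
      have h5 : y' = b α p := by
        rcases h3 with k | k
        · exact k
        · rw [k] at hg
          rw [k, G.t1_inj hα hα' hT hp hg.symm]
      rw [h5] at hy'
      exact ⟨_, e2, hy'⟩
    · have hp1 := hy α hα hT p hp rfl
      rw [G.gt2 α hα hT p hp] at hv0g
      have hv := G.R.gam3 (ty2_notin hT hp) hv0g
      obtain ⟨a, ha, hfa⟩ := sec (α p) hv.symm
      obtain ⟨a', ha', hfa'⟩ := sec (α (rf p)) (by rw [hv, hT.1 p hp])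
      rcases G.lift_any hα hp u ha with ⟨β, k1, k2⟩ | ⟨hp2, ζ, k1, k2⟩
      · exact ⟨β, fin a β hfa k1, k2⟩
      rcases G.lift_any hα (rf_mem hp) u ha' with ⟨β, l1, l2⟩ | ⟨-, ζ', l1, l2⟩
      · rw [G.R.b_rf hα hp] at l2
        exact ⟨β, fin a' β hfa' l1, l2⟩
      exfalso
      refine good G.hf G.hS G.R hα hT (cj_mem hp) hp1 (by simpa [cj] using hp2) ?_
      rw [← cj_rf]
      refine mem_closure_of_tendsto ((k2.mono_right nhdsWithin_le_nhds).prodMk_nhds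
        (l2.mono_right nhdsWithin_le_nhds)) ?_
      filter_upwards [k1, l1, hfa, hfa'] with v m1 m2 m3 m4
      refine ⟨m1.1, m2.1, ?_⟩
      rw [m1.2, m2.2, m3, m4]

end GD


def Q4 : Set (ℝ × ℝ) := {p | p ∈ circS ∧ (p.1 = 0 ∨ p.2 = 0)}

lemma Q4_finite : Q4.Finite := by
  refine (toFinite {((0 : ℝ), (1 : ℝ)), (0, -1), (1, 0), (-1, 0)}).subset ?_
  rintro ⟨x, y⟩ ⟨hp, h⟩
  have h1 : x ^ 2 + y ^ 2 = 1 := hp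
  have key : ∀ t : ℝ, t ^ 2 = 1 → t = 1 ∨ t = -1 := fun t ht =>
    sq_eq_sq_iff_eq_or_eq_neg.1 (by rw [ht]; norm_num)
  rcases h with h | h
  · simp only at h
    subst h
    rcases key y (by linarith) with rfl | rfl <;> simp
  · simp only at h
    subst h
    rcases key x (by linarith) with rfl | rfl <;> simp

/-- exceptional set -/
def bad (A : Set (ℝ × ℝ → Sph)) (b : (ℝ × ℝ → Sph) → ℝ × ℝ → Sph) (Φ f : Sph → Sph) : Set Sph :=
  Φ '' crit f ∪ ⋃ α ∈ {α | α ∈ A ∧ Ty2 f A α}, b α '' Q4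

lemma rf_self {p : ℝ × ℝ} (h : p.1 = 0) : rf p = p := by
  ext <;> simp [rf, h]

namespace GD
variable {A : Set (ℝ × ℝ → Sph)} {ext : (ℝ × ℝ → Sph) → OP → Sph}
    {B : Set (ℝ × ℝ → Sph)} {b : (ℝ × ℝ → Sph) → ℝ × ℝ → Sph} {Φ : Sph → Sph} {f g : Sph → Sph}
    (G : GD A ext B b Φ f g)
include G

lemma ty2_finite : {α | α ∈ A ∧ Ty2 f A α}.Finite := by
  have h01 : ((0, 1) : ℝ × ℝ) ∈ circS := by simp [circS]
  refine Set.Finite.of_injOn (f := fun α : ℝ × ℝ → Sph => α (0, 1)) (t := crit f) ?_ ?_ G.hf.crit_finite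
  · rintro α ⟨hα, hT⟩
    exact (c2 G.hf G.hS G.R hα hT).1
  · rintro α ⟨hα, -⟩ α' ⟨hα', -⟩ h
    exact disj_eq G.R.data.disjA hα hα' h01 h01 h

lemma bad_finite : (bad A b Φ f).Finite :=
  (G.hf.crit_finite.image Φ).union (G.ty2_finite.biUnion fun _ _ => Q4_finite.image _)

omit G in
lemma bad_ne {y : Sph} (hy : y ∉ bad A b Φ f) {α : ℝ × ℝ → Sph} (hα : α ∈ A) (hT : Ty2 f A α)
    {p : ℝ × ℝ} (hp : p ∈ circS) (h : y = b α p) : p.1 ≠ 0 ∧ p.2 ≠ 0 := by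
  constructor <;> intro h0 <;> apply hy <;> right <;>
    refine mem_biUnion (show α ∈ _ from ⟨hα, hT⟩) ⟨p, ⟨hp, ?_⟩, h.symm⟩
  · exact Or.inl h0
  · exact Or.inr h0

lemma open_bad {y : Sph} (hy : y ∉ bad A b Φ f) : 𝓝 (g y) ≤ map g (𝓝 y) :=
  G.open_at fun _ hα hT _ hp h => (bad_ne hy hα hT hp h).1

lemma perturb {y : Sph} (hy : y ∉ bad A b Φ f) (hinj : ∀ U ∈ 𝓝 y, ¬ InjOn g U) :
    ∀ U ∈ 𝓝 y, ∃ x1 y2, x1 ∉ famIm A ∧ Φ x1 ∈ U ∧ y2 ∈ U ∧ Φ x1 ≠ y2 ∧ g (Φ x1) = g y2 := by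
  intro U0 hU0
  have hU1 : U0 ∩ (bad A b Φ f)ᶜ ∈ 𝓝 y :=
    inter_mem hU0 (G.bad_finite.isClosed.isOpen_compl.mem_nhds hy)
  obtain ⟨U, hUs, hU, hyU⟩ := mem_nhds_iff.1 hU1
  have h1 := hinj U (hU.mem_nhds hyU)
  simp only [InjOn, not_forall] at h1
  obtain ⟨y1, hy1, y2, hy2, he, hne⟩ := h1
  obtain ⟨V1, V2, hV1, hV2, m1, m2, hd⟩ := t2_separation hne
  have h2 : g '' (V2 ∩ U) ∈ 𝓝 (g y2) :=
    G.open_bad (hUs hy2).2 (image_mem_map ((hV2.inter hU).mem_nhds ⟨m2, hy2⟩))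
  have h3 : IsOpen ((V1 ∩ U) ∩ g ⁻¹' interior (g '' (V2 ∩ U))) :=
    (hV1.inter hU).inter (isOpen_interior.preimage G.cont)
  obtain ⟨z, ⟨⟨hz1, hz2⟩, hz3⟩, hz4⟩ := G.R.denseB.inter_open_nonempty _ h3
    ⟨y1, ⟨m1, hy1⟩, by
      show g y1 ∈ interior (g '' (V2 ∩ U))
      rw [he]; exact mem_interior_iff_mem_nhds.2 h2⟩
  obtain ⟨x1, hx1, rfl⟩ := G.R.reg.bijOn.surjOn hz4
  obtain ⟨z2, ⟨hz5, hz6⟩, hz7⟩ := interior_subset hz3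
  refine ⟨x1, z2, hx1, (hUs hz2).1, (hUs hz6).1, ?_, hz7.symm⟩
  intro h
  rw [h] at hz1
  exact Set.disjoint_left.1 hd hz1 hz5

lemma nocrit {y X : Sph} (hy : y ∉ bad A b Φ f) (hX : (X, y) ∈ Gam A Φ) : X ∉ crit f := by
  rcases G.R.y_cases y with ⟨x0, hx0, rfl⟩ | ⟨α, hα, p, hp, rfl⟩
  · rw [G.R.gam3 hx0 hX]
    exact fun h => hy (Or.inl ⟨x0, h, rfl⟩)
  · rcases ty G.hS hα with ⟨α', hα', hT⟩ | hT
    · rcases G.R.gam4 hα hp hX with rfl | rfl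
      · exact nc1 G.hf G.hS G.R hα hα' hT hp
      · exact nc1 G.hf G.hS G.R hα hα' hT (rf_mem hp)
    · have h1 := (bad_ne hy hα hT hp rfl).1
      rcases G.R.gam4 hα hp hX with rfl | rfl
      · exact nc2 G.hf G.hS G.R hα hp h1
      · exact nc2 G.hf G.hS G.R hα (rf_mem hp) (by simpa [rf] using h1)

lemma locinj {y : Sph} (hy : y ∉ bad A b Φ f) : ∃ U ∈ 𝓝 y, InjOn g U := by
  by_contra hcon
  push Not at hcon
  have hper := G.perturb hy hcon
  let F : Filter (Sph × Sph) := comap (fun q : Sph × Sph => (Φ q.1, q.2)) (𝓝 (y, y)) ⊓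
    𝓟 {q | q.1 ∉ famIm A ∧ Φ q.1 ≠ q.2 ∧ g (Φ q.1) = g q.2}
  have hne : F.NeBot := by
    rw [inf_principal_neBot_iff]
    rintro U ⟨V, hV, hVU⟩
    rw [mem_nhds_prod_iff] at hV
    obtain ⟨V1, hV1, V2, hV2, hVs⟩ := hV
    obtain ⟨x1, y2, k1, k2, k3, k4, k5⟩ := hper _ (inter_mem hV1 hV2)
    exact ⟨(x1, y2), hVU (hVs ⟨k2.1, k3.2⟩), k1, k4, k5⟩
  let u := Ultrafilter.of F
  have hu : (u : Filter (Sph × Sph)) ≤ F := Ultrafilter.of_le F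
  have h0 : ∀ᶠ q in (u : Filter (Sph × Sph)), q.1 ∉ famIm A ∧ Φ q.1 ≠ q.2 ∧ g (Φ q.1) = g q.2 :=
    hu (mem_inf_of_right (mem_principal_self _))
  have hyy : Tendsto (fun q : Sph × Sph => (Φ q.1, q.2)) u (𝓝 (y, y)) :=
    tendsto_iff_comap.2 (hu.trans inf_le_left)
  have t1 : Tendsto (fun q : Sph × Sph => Φ q.1) u (𝓝 y) := (continuous_fst.tendsto _).comp hyy
  have t2 : Tendsto (fun q : Sph × Sph => q.2) u (𝓝 y) := (continuous_snd.tendsto _).comp hyy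
  obtain ⟨X1, hX1⟩ := ultra_lim u (fun q : Sph × Sph => q.1)
  have g1 : (X1, y) ∈ Gam A Φ := G.R.gam_lim hX1 t1 (h0.mono fun q hq => G.R.gam_graph hq.1)
  rcases u.em (fun q => q.2 ∈ famIm B) with hB | hB
  · -- the second point lies on a path of the second kind
    have h1 : ∀ᶠ q in (u : Filter (Sph × Sph)), ∃ α ∈ {α | α ∈ A ∧ Ty2 f A α},
        ∃ p ∈ circS, q.2 = b α p ∧ f q.1 = f (α p) := by
      filter_upwards [h0, hB] with q hq hqB
      rcases G.R.y_cases q.2 with ⟨x0, hx0, he⟩ | ⟨α, hα, p, hp, he⟩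
      · rw [he] at hqB
        exact absurd hqB (G.R.reg.bijOn.mapsTo (show x0 ∈ (famIm A)ᶜ from hx0))
      · have hg := hq.2.2
        rw [he, G.gphi _ hq.1] at hg
        rcases ty G.hS hα with ⟨α', hα', hT⟩ | hT
        · exfalso
          have h1 := G.gam _ _ (G.R.gam_ab hα hp)
          rw [hT p hp, ← hg] at h1
          rcases G.R.gam2 hα' hp h1 with k | k
          · exact G.R.phi_ne (fS G.hS hq.1) hα' hp k
          · exact G.R.phi_ne (fS G.hS hq.1) hα' (cj_mem hp) k
        · refine ⟨α, ⟨hα, hT⟩, p, hp, he, ?_⟩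
          rw [G.gt2 α hα hT p hp] at hg
          exact G.R.reg.bijOn.injOn (show f q.1 ∈ (famIm A)ᶜ from fS G.hS hq.1)
            (show f (α p) ∈ (famIm A)ᶜ from ty2_notin hT hp) hg
    have h2 : (⋃ α ∈ {α | α ∈ A ∧ Ty2 f A α}, {q : Sph × Sph | ∃ p ∈ circS, q.2 = b α p ∧
        f q.1 = f (α p)}) ∈ u := by
      refine mem_of_superset h1 ?_
      rintro q ⟨α, hα, h⟩
      exact mem_biUnion hα h
    rw [Ultrafilter.finite_biUnion_mem_iff G.ty2_finite] at h2
    obtain ⟨α, ⟨hα, hT⟩, h3⟩ := h2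
    have hal := G.R.data.alpha α hα
    have hch : ∀ q : Sph × Sph, ∃ p ∈ circS, (∃ p ∈ circS, q.2 = b α p ∧ f q.1 = f (α p)) →
        q.2 = b α p ∧ f q.1 = f (α p) := by
      intro q
      by_cases hq : ∃ p ∈ circS, q.2 = b α p ∧ f q.1 = f (α p)
      · obtain ⟨p, hp, h⟩ := hq
        exact ⟨p, hp, fun _ => h⟩
      · exact ⟨(0, 1), by simp [circS], fun h => absurd h hq⟩
    choose p hp hpq using hch
    have h4 : ∀ᶠ q in (u : Filter (Sph × Sph)), q.2 = b α (p q) ∧ f q.1 = f (α (p q)) :=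
      mem_of_superset h3 fun q hq => hpq q hq
    obtain ⟨r, hr, hrp⟩ := isCompact_iff_ultrafilter_le_nhds.1 circS_compact (u.map p)
      (by
        rw [Ultrafilter.coe_map, le_principal_iff]
        exact Filter.mem_map.2 (Filter.univ_mem' hp))
    have hpr : Tendsto p u (𝓝[circS] r) :=
      tendsto_nhdsWithin_iff.2 ⟨hrp, Eventually.of_forall hp⟩
    have hpr' : Tendsto (fun q => rf (p q)) u (𝓝[circS] (rf r)) :=
      tendsto_nhdsWithin_iff.2 ⟨(rf_cont.tendsto r).comp hrp, Eventually.of_forall fun q => rf_mem (hp q)⟩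
    have hyb : y = b α r := tendsto_nhds_unique t2
      ((((G.R.data.beta _ (G.R.b_mem hα)).1 r hr).tendsto.comp hpr).congr' (h4.mono fun q hq => hq.1.symm))
    obtain ⟨s, hs, hsr, hsf⟩ : ∃ s : Sph × Sph → ℝ × ℝ, (∀ q, s q ∈ circS) ∧
        Tendsto (fun q => α (s q)) u (𝓝 X1) ∧ ∀ᶠ q in (u : Filter (Sph × Sph)), f q.1 = f (α (s q)) := by
      rw [hyb] at g1
      rcases G.R.gam4 hα hr g1 with rfl | rfl
      · exact ⟨p, hp, (hal.1 r hr).tendsto.comp hpr, h4.mono fun q hq => hq.2⟩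
      · refine ⟨fun q => rf (p q), fun q => rf_mem (hp q), (hal.1 _ (rf_mem hr)).tendsto.comp hpr',
          h4.mono fun q hq => ?_⟩
        rw [hq.2, hT.1 _ (hp q)]
    obtain ⟨U, hU, hXU, hinj⟩ := inj_nhd (G.nocrit hy g1)
    obtain ⟨q, ⟨k1, k2⟩, ⟨k3, k4⟩⟩ := ((h0.and hsf).and
      ((hX1.eventually (hU.mem_nhds hXU)).and (hsr.eventually (hU.mem_nhds hXU)))).exists
    have := hinj k3 k4 k2
    apply k1.1
    rw [this]
    exact mem_fam hα (hs q)
  · have hch : ∀ q : Sph × Sph, ∃ x, q.2 ∉ famIm B → x ∉ famIm A ∧ q.2 = Φ x := by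
      intro q
      by_cases hq : q.2 ∈ famIm B
      · exact ⟨q.1, fun h => absurd hq h⟩
      · obtain ⟨x, hx, he⟩ := G.R.reg.bijOn.surjOn (show q.2 ∈ (famIm B)ᶜ from hq)
        exact ⟨x, fun _ => ⟨hx, he.symm⟩⟩
    choose x hx using hch
    have h1 : ∀ᶠ q in (u : Filter (Sph × Sph)), x q ∉ famIm A ∧ q.2 = Φ (x q) :=
      hB.mono fun q hq => hx q hq
    have h2 : ∀ᶠ q in (u : Filter (Sph × Sph)), q.1 ≠ x q ∧ f q.1 = f (x q) := by
      filter_upwards [h0, h1] with q k1 k2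
      refine ⟨fun h => k1.2.1 (by rw [k2.2, ← h]), ?_⟩
      have := k1.2.2
      rw [k2.2, G.gphi _ k1.1, G.gphi _ k2.1] at this
      exact G.R.reg.bijOn.injOn (show f q.1 ∈ (famIm A)ᶜ from fS G.hS k1.1)
        (show f (x q) ∈ (famIm A)ᶜ from fS G.hS k2.1) this
    have t3 : Tendsto (fun q => Φ (x q)) u (𝓝 y) := t2.congr' (h1.mono fun q hq => hq.2)
    obtain ⟨X2, hX2⟩ := ultra_lim u x
    have g2 : (X2, y) ∈ Gam A Φ := G.R.gam_lim hX2 t3 (h1.mono fun q hq => G.R.gam_graph hq.1)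
    have hff : f X1 = f X2 := tendsto_nhds_unique ((G.hf.1.tendsto X1).comp hX1)
      (((G.hf.1.tendsto X2).comp hX2).congr' (h2.mono fun q hq => hq.2.symm))
    have hXne : X1 ≠ X2 := by
      rintro rfl
      obtain ⟨U, hU, hXU, hinj⟩ := inj_nhd (G.nocrit hy g1)
      obtain ⟨q, k1, ⟨k3, k4⟩⟩ := (h2.and
        ((hX1.eventually (hU.mem_nhds hXU)).and (hX2.eventually (hU.mem_nhds hXU)))).exists
      exact k1.1 (hinj k3 k4 k1.2)
    rcases G.R.y_cases y with ⟨x0, hx0, rfl⟩ | ⟨α, hα, p, hp, rfl⟩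
    · exact hXne ((G.R.gam3 hx0 g1).trans (G.R.gam3 hx0 g2).symm)
    have hal := G.R.data.alpha α hα
    have hE := G.R.data.extOk α hα
    obtain ⟨r, hr, hrp, hr1, hr2⟩ : ∃ r ∈ circS, (r = p ∨ r = rf p) ∧ X1 = α r ∧ X2 = α (rf r) := by
      rcases G.R.gam4 hα hp g1 with k1 | k1 <;> rcases G.R.gam4 hα hp g2 with k2 | k2
      · exact absurd (k1.trans k2.symm) hXne
      · exact ⟨p, hp, Or.inl rfl, k1, k2⟩
      · exact ⟨rf p, rf_mem hp, Or.inr rfl, k1, by rw [rf_rf]; exact k2⟩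
      · exact absurd (k1.trans k2.symm) hXne
    rcases ty G.hS hα with ⟨α', hα', hT⟩ | hT
    · rw [hr1, hr2, hT r hr, hT _ (rf_mem hr)] at hff
      rcases (alpha_eq (G.R.data.alpha α' hα') hr (rf_mem hr)).1 hff with k | k
      · rw [← k] at hr2
        exact hXne (hr1.trans hr2.symm)
      · rw [cj_rf] at k
        exact neg_ne hr k
    · have hpne := bad_ne hy hα hT hp rfl
      have hrne : r.1 ≠ 0 ∧ r.2 ≠ 0 := by
        rcases hrp with rfl | rfl
        · exact hpne
        · exact ⟨by simpa [rf] using hpne.1, hpne.2⟩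
      have lift : ∀ (s : ℝ × ℝ) (z : Sph × Sph → Sph), s ∈ circS → s.2 = p.2 → s.2 ≠ 0 →
          Tendsto z u (𝓝 (α s)) → (∀ᶠ q in (u : Filter (Sph × Sph)), z q ∉ famIm A) →
          Tendsto (fun q => Φ (z q)) u (𝓝 (b α p)) →
          ∃ ζ : Sph × Sph → ℝ × ℝ, (∀ᶠ q in (u : Filter (Sph × Sph)), ζ q ∈ outS ∧ ext α (ζ q) = z q) ∧
            Tendsto ζ u (𝓝 s) := by
        intro s z hs hsp hs0 hz hzA hzΦ
        obtain ⟨ζ, hζ, hor⟩ := lift_out hal hE u hs hz (hzA.mono fun q hq => notin_path hα hq)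
        rcases hor with k | k
        · exact ⟨ζ, hζ, k.mono_right nhdsWithin_le_nhds⟩
        · exfalso
          have hgk : ∀ᶠ q in (u : Filter (Sph × Sph)), (ext α (ζ q), Φ (z q)) ∈ Gam A Φ := by
            filter_upwards [hζ, hzA] with q k1 k2
            rw [k1.2]; exact G.R.gam_graph k2
          have e := tendsto_nhds_unique (G.R.gam_key hα (cj_mem hs) k hgk) hzΦ
          have e2 : (cj s).2 = p.2 := by
            rcases (G.R.b_eq hα hα (cj_mem hs) hp e).2 with k | k
            · rw [k]
            · rw [k]; rfl
          simp only [cj] at e2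
          apply hs0; linarith
      have hrp2 : r.2 = p.2 := by
        rcases hrp with rfl | rfl <;> rfl
      rw [hr1] at hX1
      rw [hr2] at hX2
      obtain ⟨ζ, z1, z2⟩ := lift r (fun q => q.1) hr hrp2 hrne.2 hX1 (h0.mono fun q hq => hq.1) t1
      obtain ⟨ζ', z1', z2'⟩ := lift (rf r) x (rf_mem hr) hrp2 hrne.2 hX2 (h1.mono fun q hq => hq.1) t3
      refine good G.hf G.hS G.R hα hT hr hrne.1 hrne.2 ?_
      refine mem_closure_of_tendsto (z2.prodMk_nhds z2') ?_
      filter_upwards [z1, z1', h2] with q k1 k2 k3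
      refine ⟨k1.1, k2.1, ?_⟩
      rw [k1.2, k2.2, k3.2]

lemma ramified : IsRamifiedCovering g := by
  refine ⟨G.cont, fun y => ?_⟩
  apply stoilow G.cont
  · have h1 : (bad A b Φ f \ {y})ᶜ ∈ 𝓝 y :=
      (G.bad_finite.subset sdiff_subset).isClosed.isOpen_compl.mem_nhds (by simp)
    filter_upwards [mem_nhdsWithin_of_mem_nhds h1, self_mem_nhdsWithin] with z hz hzy
    have hzb : z ∉ bad A b Φ f := fun h => hz ⟨h, hzy⟩
    obtain ⟨U, hU, hinj⟩ := G.locinj hzb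
    obtain ⟨W, hWU, hW, hzW⟩ := mem_nhds_iff.1 hU
    have hW2 : IsOpen (W ∩ (bad A b Φ f)ᶜ) := hW.inter G.bad_finite.isClosed.isOpen_compl
    refine ⟨W ∩ (bad A b Φ f)ᶜ, hW2.mem_nhds ⟨hzW, hzb⟩, hW2, hinj.mono (inter_subset_left.trans hWU), ?_⟩
    intro O hO hOo
    rw [isOpen_iff_mem_nhds]
    rintro _ ⟨t, ht, rfl⟩
    exact G.open_bad (hO ht).2 (image_mem_map (hOo.mem_nhds ht))
  · have h1 : (g ⁻¹' {g y} \ {y})ᶜ ∈ 𝓝 y :=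
      ((G.fib_finite (g y)).subset sdiff_subset).isClosed.isOpen_compl.mem_nhds (by simp)
    filter_upwards [mem_nhdsWithin_of_mem_nhds h1, self_mem_nhdsWithin] with z hz hzy h
    exact hz ⟨h, hzy⟩

end GD

/-- If `f : S² → S²` is a ramified covering, `𝒜` a contracted countable
strongly `f`-stable set of disjoint α-paths, and `Φ` a regluing of `𝒜` into a contracted set
`ℬ` of disjoint β-paths, then `Φ ∘ f ∘ Φ⁻¹` extends to a continuous map `g : S² → S²` that is
a ramified covering. -/
theorem regluing_of_ramified_covering (f : Sph → Sph) (hf : IsRamifiedCovering f)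
    (A B : Set (ℝ × ℝ → Sph)) (ext : (ℝ × ℝ → Sph) → OP → Sph)
    (b : (ℝ × ℝ → Sph) → ℝ × ℝ → Sph) (Φ : Sph → Sph)
    (hA : A.Countable) (hcontrA : Contracted (pathIm '' A))
    (hcontrB : Contracted (pathIm '' B)) (hstable : StronglyFStable f A)
    (hdata : RegluingData A ext B b) (hreg : IsRegluing A ext B b Φ) :
    ∃ g : Sph → Sph, Continuous g ∧ IsRamifiedCovering g ∧
      ∀ x ∈ (famIm A)ᶜ, g (Φ x) = Φ (f x) := by
  obtain ⟨g, G⟩ := exists_GD hf hstable (⟨hdata, hreg, hA⟩ : Reg A ext B b Φ)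
  exact ⟨g, G.cont, G.ramified, fun x hx => G.gphi x hx⟩
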